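/- arXiv:2403.05254 — 6 statements merged into one kernel-verified Lean document; each statement's English description precedes it below -/
import Mathlib

section
/- Let G be a k-regular finite simple graph of order n with k ≥ 1. Then es_Δ(G) = n − α′(G), where α′(G) denotes the matching number of G. -/
open SimpleGraph

attribute [local instance] Classical.propDecidable

universe u

variable {V : Type u}

/-- A set of edges of `G` is *mitigating* if its removal decreases the maximum degree
of `G` by exactly one. -/
def SimpleGraph.IsMitigating [Fintype V] (G : SimpleGraph V) (S : Set (Sym2 V)) : Prop :=
  S ⊆ G.edgeSet ∧ (G.deleteEdges S).maxDegree = G.maxDegree - 1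

/-- The Δ-edge stability number `es_Δ(G)`: the minimum cardinality of a mitigating set. -/
noncomputable def SimpleGraph.esDelta [Fintype V] (G : SimpleGraph V) : ℕ :=
  sInf {n | ∃ S : Set (Sym2 V), G.IsMitigating S ∧ S.ncard = n}

/-- The matching number of `G`: the maximum cardinality of a matching of `G`. -/
noncomputable def SimpleGraph.matchNumber [Fintype V] (G : SimpleGraph V) : ℕ :=
  sSup {n | ∃ M : G.Subgraph, M.IsMatching ∧ M.edgeSet.ncard = n}

namespace SimpleGraph

/-- A set of edges of `G` is an *edge cover* if every vertex is an endpoint of one of its edges. -/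
def IsEdgeCover (G : SimpleGraph V) (S : Set (Sym2 V)) : Prop :=
  S ⊆ G.edgeSet ∧ ∀ v, ∃ e ∈ S, v ∈ e

variable [Fintype V] {G : SimpleGraph V}

lemma Subgraph.IsMatching.ncard_verts {M : G.Subgraph} (hM : M.IsMatching) :
    M.verts.ncard = 2 * M.edgeSet.ncard := by
  have hdeg : ∀ v ∈ M.spanningCoe.support, M.spanningCoe.degree v = 1 := by
    rintro v ⟨w, hw⟩
    rw [← card_neighborFinset_eq_degree, Finset.card_eq_one]
    refine ⟨w, Finset.ext fun x ↦ ?_⟩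
    rw [mem_neighborFinset, Finset.mem_singleton]
    exact ⟨fun hx ↦ hM.eq_of_adj_left hx hw, fun hx ↦ hx ▸ hw⟩
  have hsupp : M.spanningCoe.support = M.verts := hM.support_eq_verts
  have h := M.spanningCoe.sum_degrees_support_eq_twice_card_edges
  rw [Finset.sum_congr rfl fun v hv ↦ hdeg v (by simpa using hv), Finset.sum_const, smul_eq_mul,
    mul_one, ← Set.ncard_eq_toFinset_card', hsupp, ← Set.ncard_coe_finset, coe_edgeFinset] at h
  simpa using h

lemma Subgraph.IsMatching.card_eq {M : G.Subgraph} (hM : M.IsMatching) :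
    Fintype.card V = 2 * M.edgeSet.ncard + M.vertsᶜ.ncard := by
  rw [← hM.ncard_verts, Set.ncard_add_ncard_compl, Nat.card_eq_fintype_card]

lemma IsEdgeCover.exists_isMatching {S : Set (Sym2 V)} (hS : G.IsEdgeCover S) :
    ∃ M : G.Subgraph, M.IsMatching ∧ Fintype.card V ≤ S.ncard + M.edgeSet.ncard := by
  obtain ⟨M, ⟨hM, hMS⟩, hmax⟩ := Set.exists_max_image
    {M : G.Subgraph | M.IsMatching ∧ M.edgeSet ⊆ S} (fun M ↦ M.edgeSet.ncard) (Set.toFinite _)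
    ⟨⊥, fun v hv ↦ hv.elim, by simp⟩
  refine ⟨M, hM, ?_⟩
  have hindep : ∀ v w, s(v, w) ∈ S → v ∉ M.verts → w ∈ M.verts := by
    intro v w hvw hv
    by_contra hw
    have hadj : G.Adj v w := hS.1 hvw
    have hN : (M ⊔ G.subgraphOfAdj hadj).IsMatching := by
      refine hM.sup (.subgraphOfAdj hadj) ?_
      rw [support_subgraphOfAdj, hM.support_eq_verts]
      simp [hv, hw]
    have hnot : s(v, w) ∉ M.edgeSet := fun h ↦ hv (M.edge_vert h)
    have hle := hmax _ ⟨hN, by simp [Set.insert_subset_iff, hvw, hMS]⟩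
    simp [Set.ncard_insert_of_notMem hnot] at hle
  choose f hf hmem using hS.2
  have hinj : M.vertsᶜ.ncard ≤ (S \ M.edgeSet).ncard := by
    refine Set.ncard_le_ncard_of_injOn f (fun v hv ↦ ⟨hf v, fun h ↦ ?_⟩) fun v hv w hw hvw ↦ ?_
    · exact hv (M.mem_verts_of_mem_edge h (hmem v))
    · by_contra hne
      have he := (Sym2.mem_and_mem_iff hne).1 ⟨hmem v, hvw ▸ hmem w⟩
      exact hw (hindep v w (he ▸ hf v) hv)
  have hdiff := Set.ncard_sdiff_add_ncard_of_subset hMS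
  have hcard := hM.card_eq
  omega

lemma Subgraph.IsMatching.exists_isEdgeCover (hG : ∀ v, ∃ w, G.Adj v w) {M : G.Subgraph}
    (hM : M.IsMatching) :
    ∃ S, G.IsEdgeCover S ∧ S.ncard + M.edgeSet.ncard ≤ Fintype.card V := by
  choose f hf using hG
  refine ⟨M.edgeSet ∪ (fun v ↦ s(v, f v)) '' M.vertsᶜ, ⟨?_, fun v ↦ ?_⟩, ?_⟩
  · refine Set.union_subset M.edgeSet_subset ?_
    rintro _ ⟨v, -, rfl⟩
    exact hf v
  · by_cases hv : v ∈ M.verts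
    · obtain ⟨w, hw, -⟩ := hM hv
      exact ⟨s(v, w), .inl hw, Sym2.mem_mk_left v w⟩
    · exact ⟨s(v, f v), .inr ⟨v, hv, rfl⟩, Sym2.mem_mk_left v _⟩
  · have hunion := Set.ncard_union_le M.edgeSet ((fun v ↦ s(v, f v)) '' M.vertsᶜ)
    have himage := Set.ncard_image_le (f := fun v ↦ s(v, f v)) (s := M.vertsᶜ)
    have hcard := hM.card_eq
    omega

lemma IsMitigating.isEdgeCover [Nonempty V] {k : ℕ} (hk : 1 ≤ k) (hreg : G.IsRegularOfDegree k)
    {S : Set (Sym2 V)} (hS : G.IsMitigating S) : G.IsEdgeCover S := by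
  refine ⟨hS.1, fun v ↦ ?_⟩
  by_contra! hv
  have hdeg : (G.deleteEdges S).degree v = G.degree v := by
    unfold degree
    congr 1
    ext w
    simp only [mem_neighborFinset, deleteEdges_adj, and_iff_left_iff_imp]
    exact fun _ h ↦ hv _ h (Sym2.mem_mk_left v w)
  have hle := (G.deleteEdges S).degree_le_maxDegree v
  have hmax := hS.2
  rw [hreg.maxDegree_eq] at hmax
  rw [hdeg, hreg.degree_eq v] at hle
  omega

lemma IsEdgeCover.isMitigating [Nonempty V] {k : ℕ} (hreg : G.IsRegularOfDegree k)
    {S : Set (Sym2 V)} (hS : G.IsEdgeCover S)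
    (hmin : ∀ T, G.IsEdgeCover T → S.ncard ≤ T.ncard) : G.IsMitigating S := by
  refine ⟨hS.1, ?_⟩
  rw [hreg.maxDegree_eq]
  refine le_antisymm (maxDegree_le_of_forall_degree_le _ _ fun v ↦ ?_) ?_
  · obtain ⟨e, he, hv⟩ := hS.2 v
    obtain ⟨w, rfl⟩ := hv
    refine Nat.le_sub_one_of_lt (lt_of_lt_of_eq (Finset.card_lt_card ?_) (hreg.degree_eq v))
    refine Finset.ssubset_iff_subset_ne.2 ⟨fun x hx ↦ ?_, fun h ↦ ?_⟩
    · simp only [mem_neighborFinset, deleteEdges_adj] at hx ⊢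
      exact hx.1
    · have hw : w ∈ G.neighborFinset v := by simpa using hS.1 he
      rw [← h] at hw
      simp [he] at hw
  · obtain ⟨e, he, -⟩ := hS.2 (Classical.arbitrary V)
    have hnot : ¬ G.IsEdgeCover (S \ {e}) := fun h ↦
      (hmin _ h).not_gt (Set.ncard_sdiff_singleton_lt_of_mem he)
    obtain ⟨v, hv⟩ : ∃ v, ∀ e' ∈ S \ {e}, v ∉ e' := by
      by_contra! h
      exact hnot ⟨Set.sdiff_subset.trans hS.1, h⟩
    have hve : ∀ e' ∈ S, v ∈ e' → e' = e := fun e' he' hmem ↦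
      by_contra fun hne ↦ hv e' ⟨he', hne⟩ hmem
    obtain ⟨e', he', w, rfl⟩ := hS.2 v
    refine le_trans ?_ (degree_le_maxDegree _ v)
    have hsub : G.neighborFinset v ⊆ insert w ((G.deleteEdges S).neighborFinset v) := by
      intro x hx
      rw [Finset.mem_insert, mem_neighborFinset, deleteEdges_adj]
      refine or_iff_not_imp_left.2 fun hxw ↦ ⟨by simpa using hx, fun hxS ↦ hxw ?_⟩
      exact Sym2.congr_right.1 ((hve _ hxS (Sym2.mem_mk_left _ _)).trans
        (hve _ he' (Sym2.mem_mk_left _ _)).symm)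
    have hcard := (Finset.card_le_card hsub).trans (Finset.card_insert_le _ _)
    rw [card_neighborFinset_eq_degree, card_neighborFinset_eq_degree, hreg.degree_eq v] at hcard
    omega

lemma bddAbove_ncard_isMatching (G : SimpleGraph V) :
    BddAbove {n | ∃ M : G.Subgraph, M.IsMatching ∧ M.edgeSet.ncard = n} := by
  refine ⟨G.edgeSet.ncard, ?_⟩
  rintro _ ⟨M, -, rfl⟩
  exact Set.ncard_le_ncard M.edgeSet_subset

end SimpleGraph

/-- For a `k`-regular graph with `k ≥ 1`: `es_Δ(G) = n − α′(G)`. -/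
theorem stmt_11 [Fintype V] (G : SimpleGraph V) (k : ℕ) (hk : 1 ≤ k)
    (hreg : G.IsRegularOfDegree k) (hE : G.edgeSet.Nonempty) :
    G.esDelta = Fintype.card V - G.matchNumber := by
  obtain ⟨⟨a, b⟩, hab⟩ := hE
  have : Nonempty V := ⟨a⟩
  have hG : ∀ v, ∃ w, G.Adj v w := fun v ↦
    (G.degree_pos_iff_exists_adj v).1 (by rw [hreg.degree_eq v]; omega)
  obtain ⟨M, hM, hMcard⟩ := Nat.sSup_mem
    (s := {n | ∃ M : G.Subgraph, M.IsMatching ∧ M.edgeSet.ncard = n})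
    ⟨_, ⊥, fun v hv ↦ hv.elim, rfl⟩ G.bddAbove_ncard_isMatching
  obtain ⟨S, hS, hScard⟩ := hM.exists_isEdgeCover hG
  obtain ⟨T, hT, hTmin⟩ := Set.exists_min_image {T | G.IsEdgeCover T} Set.ncard
    (Set.toFinite _) ⟨S, hS⟩
  have hTmit : G.IsMitigating T := IsEdgeCover.isMitigating hreg hT hTmin
  have hesle : G.esDelta ≤ T.ncard := Nat.sInf_le ⟨T, hTmit, rfl⟩
  have hTS := hTmin S hS
  obtain ⟨U, hU, hUcard⟩ := Nat.sInf_mem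
    (s := {n | ∃ S : Set (Sym2 V), G.IsMitigating S ∧ S.ncard = n}) ⟨_, T, hTmit, rfl⟩
  obtain ⟨N, hN, hNcard⟩ := (hU.isEdgeCover hk hreg).exists_isMatching
  have hNle : N.edgeSet.ncard ≤ G.matchNumber :=
    le_csSup G.bddAbove_ncard_isMatching ⟨N, hN, rfl⟩
  change U.ncard = G.esDelta at hUcard
  change M.edgeSet.ncard = G.matchNumber at hMcard
  omega
end

section
/- For every real ε > 0 there exists N such that every connected finite simple graph G of order n ≥ N with at least one edge satisfies es_Δ(G) ≤ (5/9 + ε)·n. -/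
open SimpleGraph

attribute [local instance] Classical.propDecidable

universe u

variable {V : Type u}

open Finset

namespace SimpleGraph

theorem Connected.two_mul_card_le_of_surjective {W D : Type*} [Fintype W] [Fintype D]
    {G : SimpleGraph W} (hG : G.Connected) {F : W → D} (hF : F.Surjective) :
    2 * Fintype.card D ≤ (∑ v, #{w | G.Adj v w ∧ F v ≠ F w}) + 2 := by
  let Q : SimpleGraph D :=
    { Adj := fun a b => a ≠ b ∧ ∃ u v, G.Adj u v ∧ F u = a ∧ F v = b
      symm := ⟨by
        rintro a b ⟨hab, u, v, huv, hu, hv⟩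
        exact ⟨hab.symm, v, u, huv.symm, hv, hu⟩⟩
      loopless := ⟨fun a h => h.1 rfl⟩ }
  have hreach : ∀ u v, G.Walk u v → Q.Reachable (F u) (F v) := by
    intro u v p
    induction p with
    | nil => exact Reachable.refl _
    | @cons u v w h p ih =>
      by_cases hne : F u = F v
      · rwa [hne]
      · exact (Adj.reachable (G := Q) ⟨hne, u, v, h, rfl, rfl⟩).trans ih
  have hQ : Q.Connected := by
    obtain ⟨w⟩ := hG.nonempty
    have : Nonempty D := ⟨F w⟩
    refine ⟨fun a b => ?_⟩
    obtain ⟨u, rfl⟩ := hF a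
    obtain ⟨v, rfl⟩ := hF b
    obtain ⟨p⟩ := hG.preconnected u v
    exact hreach u v p
  have h1 := hQ.card_vert_le_card_edgeSet_add_one
  rw [Nat.card_eq_fintype_card, Nat.card_eq_fintype_card, ← edgeFinset_card] at h1
  have h2 := Q.two_mul_card_edgeFinset
  have h3 : #(univ.filter fun x : D × D => Q.Adj x.1 x.2) ≤
      #(univ.sigma fun v : W => ({w | G.Adj v w ∧ F v ≠ F w} : Finset W)) := by
    refine (card_le_card ?_).trans (card_image_le (f := fun x : (_ : W) × W => (F x.1, F x.2)))
    rintro ⟨a, b⟩ hab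
    obtain ⟨hne, u, v, huv, rfl, rfl⟩ := (mem_filter.1 hab).2
    exact mem_image.2 ⟨⟨u, v⟩, by simp [huv, hne], rfl⟩
  rw [card_sigma] at h3
  change 2 * _ = #(univ.filter fun x : D × D => Q.Adj x.1 x.2) at h2
  omega

theorem exists_sum_card_adj_eq_two_mul {W : Type*} [Fintype W] (G : SimpleGraph W)
    (A : Finset W) : ∃ k, ∑ v ∈ A, #{w ∈ A | G.Adj v w} = 2 * k := by
  let H : SimpleGraph W :=
    { Adj := fun u v => u ∈ A ∧ v ∈ A ∧ G.Adj u v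
      symm := ⟨fun u v h => ⟨h.2.1, h.1, h.2.2.symm⟩⟩
      loopless := ⟨fun a h => G.loopless.irrefl a h.2.2⟩ }
  refine ⟨#H.edgeFinset, ?_⟩
  rw [H.two_mul_card_edgeFinset, ← card_sigma]
  refine card_bij (fun x _ => (x.1, x.2)) ?_ ?_ ?_
  · rintro ⟨a, b⟩ h
    simp only [mem_sigma, mem_filter] at h
    simpa [H] using h
  · rintro ⟨a, b⟩ _ ⟨c, d⟩ _ h
    simpa using h
  · rintro ⟨a, b⟩ h
    exact ⟨⟨a, b⟩, by simpa [H] using h, rfl⟩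

section Boundary

variable {W : Type*} {G : SimpleGraph W} {A R : Finset W} {d : ℕ}

theorem card_mul_eq_sum_boundary [Fintype W] (hAR : Disjoint A R) (hd : ∀ v ∈ A, G.degree v = d)
    (hcl : ∀ v ∈ A, ∀ w, G.Adj v w → w ∈ A ∨ w ∈ R) :
    #A * d = ∑ v ∈ A, #{w ∈ R | G.Adj v w} + ∑ v ∈ A, #{w ∈ A | G.Adj v w} := by
  rw [← sum_add_distrib, ← smul_eq_mul, ← sum_const]
  refine sum_congr rfl fun v hv => ?_
  rw [← hd v hv, ← card_neighborFinset_eq_degree, ← card_union_of_disjoint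
    (disjoint_filter_filter hAR.symm)]
  congr 1
  ext w
  simp only [mem_neighborFinset, mem_union, mem_filter]
  exact ⟨fun h => (hcl v hv w h).elim (fun h' => .inr ⟨h', h⟩) fun h' => .inl ⟨h', h⟩,
    fun h => h.elim And.right And.right⟩

theorem sum_card_adj_le {W : Type*} (G : SimpleGraph W) (A : Finset W) :
    ∑ v ∈ A, #{w ∈ A | G.Adj v w} ≤ #A * (#A - 1) := by
  rw [← smul_eq_mul]
  refine sum_le_card_nsmul _ _ _ fun v hv => ?_
  rw [← card_erase_of_mem hv]
  refine card_le_card fun w hw => ?_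
  rw [mem_filter] at hw
  exact mem_erase.2 ⟨hw.2.ne', hw.1⟩

theorem Connected.boundary_pos (hG : G.Connected) (hAR : Disjoint A R) (hA : A.Nonempty)
    (hR : R.Nonempty) (hcl : ∀ v ∈ A, ∀ w, G.Adj v w → w ∈ A ∨ w ∈ R) :
    0 < ∑ v ∈ A, #{w ∈ R | G.Adj v w} := by
  by_contra! h
  have h0 : ∀ v ∈ A, ∀ w ∈ R, ¬ G.Adj v w := by
    simpa [filter_eq_empty_iff] using h
  have hw : ∀ u v, G.Walk u v → u ∈ A → v ∈ A := by
    intro u v p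
    induction p with
    | nil => exact id
    | @cons u v w h p ih =>
      exact fun hu => ih ((hcl u hu v h).resolve_right fun hv => h0 u hu v hv h)
  obtain ⟨a, ha⟩ := hA
  obtain ⟨r, hr⟩ := hR
  obtain ⟨p⟩ := hG.preconnected a r
  exact Finset.disjoint_left.1 hAR (hw a r p ha) hr

end Boundary

theorem odd_class_bounds {s e d k : ℕ} (hs : Odd s) (he : 0 < e) (h1 : s * d = e + 2 * k)
    (h2 : 2 * k ≤ s * (s - 1)) :
    (d = 3 → 7 ≤ 2 * e + s) ∧ (d = 5 → 34 ≤ 6 * e + 4 * s) ∧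
      (d ≠ 3 → d ≠ 5 → 9 * d ≤ 8 * e + s * d) := by
  obtain h9 | h9 := le_or_gt 9 s
  · refine ⟨by omega, by omega, fun _ _ => ?_⟩
    have := Nat.mul_le_mul_right d h9
    omega
  · obtain ⟨m, rfl⟩ := hs
    have hm : m < 4 := by omega
    obtain hd | hd := le_or_gt 7 d
    · interval_cases m <;> norm_num at h1 h2 ⊢ <;> omega
    · interval_cases m <;> interval_cases d <;> norm_num at h1 h2 ⊢ <;> omega

theorem Connected.nine_mul_card_odd_le {W C : Type*} [Fintype W] [Fintype C]
    {G : SimpleGraph W} (hG : G.Connected) (R : Finset W)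
    (hR : ∀ v, v ∉ R → G.degree v = G.maxDegree) (f : W → C)
    (hsurj : ∀ c, ∃ v, v ∉ R ∧ f v = c)
    (hf : ∀ u v, u ∉ R → v ∉ R → G.Adj u v → f u = f v) :
    9 * #{c | Odd #{v | v ∉ R ∧ f v = c}} ≤ Fintype.card W + 9 * #R + 9 := by
  set Δ := G.maxDegree with hΔ
  set A : C → Finset W := fun c => {v | v ∉ R ∧ f v = c} with hA
  set O : Finset C := {c | Odd #(A c)} with hO
  set e : C → ℕ := fun c => ∑ v ∈ A c, #{w ∈ R | G.Adj v w} with he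
  set E : ℕ := ∑ v ∈ Rᶜ, #{w ∈ R | G.Adj v w} with hE
  have hAfib : ∀ c, A c = {v ∈ Rᶜ | f v = c} := fun c => by ext; simp [hA]
  have hdisj : ∀ c, Disjoint (A c) R := fun c => by
    simp +contextual [hA, Finset.disjoint_left]
  have hcl : ∀ c, ∀ v ∈ A c, ∀ w, G.Adj v w → w ∈ A c ∨ w ∈ R := by
    intro c v hv w hvw
    simp only [hA, mem_filter, mem_univ, true_and] at hv ⊢
    by_cases hw : w ∈ R
    · exact .inr hw
    · exact .inl ⟨hw, (hf v w hv.1 hw hvw).symm.trans hv.2⟩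
  have hdegA : ∀ c, ∀ v ∈ A c, G.degree v = Δ := fun c v hv => by
    simp only [hA, mem_filter, mem_univ, true_and] at hv
    exact hR v hv.1
  have hOC : #O ≤ Fintype.card C := card_le_univ _
  have hsize : ∑ c ∈ O, #(A c) + #R ≤ Fintype.card W := by
    have h1 : ∑ c ∈ O, #(A c) ≤ ∑ c, #(A c) := sum_le_sum_of_subset (subset_univ _)
    have h2 : #Rᶜ = ∑ c, #(A c) := by
      simp only [hAfib]
      exact card_eq_sum_card_fiberwise fun _ _ => mem_univ _
    have h3 := card_add_card_compl R
    omega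
  have heE : ∑ c ∈ O, e c ≤ E := by
    have h1 : ∑ c ∈ O, e c ≤ ∑ c, e c := sum_le_sum_of_subset (subset_univ _)
    have h2 : ∑ c, e c = E := by
      simp only [he, hE, hAfib]
      exact sum_fiberwise _ _ _
    omega
  have hER : E ≤ #R * Δ := by
    have h1 : E = ∑ w ∈ R, #{v ∈ Rᶜ | G.Adj v w} :=
      sum_card_bipartiteAbove_eq_sum_card_bipartiteBelow _
    rw [h1, ← smul_eq_mul]
    refine sum_le_card_nsmul _ _ _ fun w _ => ?_
    refine le_trans (card_le_card fun v hv => ?_) (G.degree_le_maxDegree w)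
    simpa using (mem_filter.1 hv).2.symm
  have hconn : 2 * (#R + Fintype.card C) ≤ #R * Δ + E + 2 := by
    let F : W → R ⊕ C := fun v => if h : v ∈ R then .inl ⟨v, h⟩ else .inr (f v)
    have hF : F.Surjective := by
      rintro (⟨v, hv⟩ | c)
      · exact ⟨v, by simp [F, hv]⟩
      · obtain ⟨v, hv, rfl⟩ := hsurj c
        exact ⟨v, by simp [F, hv]⟩
    have h1 := hG.two_mul_card_le_of_surjective hF
    rw [Fintype.card_sum, Fintype.card_coe, ← sum_add_sum_compl R] at h1
    refine h1.trans (Nat.add_le_add_right (Nat.add_le_add ?_ ?_) 2)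
    · rw [← smul_eq_mul]
      refine sum_le_card_nsmul _ _ _ fun v _ => le_trans (card_le_card fun w hw => ?_)
        (G.degree_le_maxDegree v)
      simp only [mem_filter, mem_univ, true_and] at hw
      simpa using hw.1
    · refine sum_le_sum fun v hv => card_le_card fun w hw => ?_
      simp only [mem_filter, mem_univ, true_and] at hw
      obtain ⟨hvw, hne⟩ := hw
      refine mem_filter.2 ⟨?_, hvw⟩
      by_contra hwR
      have hvR := mem_compl.1 hv
      exact hne (by simp [F, hvR, hwR, hf v w hvR hwR hvw])
  obtain hRe | hRe := R.eq_empty_or_nonempty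
  · simp only [hRe, card_empty, zero_mul, mul_zero] at hconn hER ⊢
    omega
  have hbd : ∀ c ∈ O, (Δ = 3 → 7 ≤ 2 * e c + #(A c)) ∧ (Δ = 5 → 34 ≤ 6 * e c + 4 * #(A c)) ∧
      (Δ ≠ 3 → Δ ≠ 5 → 9 * Δ ≤ 8 * e c + #(A c) * Δ) := by
    intro c hc
    have hodd : Odd #(A c) := (mem_filter.1 hc).2
    obtain ⟨k, hk⟩ := G.exists_sum_card_adj_eq_two_mul (A c)
    have h1 := card_mul_eq_sum_boundary (hdisj c) (hdegA c) (hcl c)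
    have h2 := G.sum_card_adj_le (A c)
    have h3 := hG.boundary_pos (hdisj c) (card_pos.1 hodd.pos) hRe (hcl c)
    rw [hk] at h1 h2
    exact odd_class_bounds hodd h3 h1 h2
  by_cases h3 : Δ = 3
  · have := card_nsmul_le_sum O _ 7 fun c hc => (hbd c hc).1 h3
    rw [sum_add_distrib, ← mul_sum, smul_eq_mul] at this
    rw [h3] at hER hconn
    omega
  by_cases h5 : Δ = 5
  · have := card_nsmul_le_sum O _ 34 fun c hc => (hbd c hc).2.1 h5
    rw [sum_add_distrib, ← mul_sum, ← mul_sum, smul_eq_mul] at this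
    rw [h5] at hER hconn
    omega
  · have h := card_nsmul_le_sum O _ (9 * Δ) fun c hc => (hbd c hc).2.2 h3 h5
    rw [sum_add_distrib, ← mul_sum, ← sum_mul, smul_eq_mul] at h
    obtain h0 | h0 := Nat.eq_zero_or_pos Δ
    · rw [h0] at hER hconn
      omega
    · have : #O * 9 ≤ 8 * #R + ∑ c ∈ O, #(A c) := by
        refine Nat.le_of_mul_le_mul_right ?_ h0
        nlinarith
      omega

theorem esDelta_le_ncard {W : Type*} [Fintype W] {G : SimpleGraph W} {S : Set (Sym2 W)}
    (hS : S ⊆ G.edgeSet) (hlt : (G.deleteEdges S).maxDegree < G.maxDegree) :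
    G.esDelta ≤ S.ncard := by
  suffices ∃ T ⊆ S, (G.deleteEdges T).maxDegree = G.maxDegree - 1 by
    obtain ⟨T, hTS, hT⟩ := this
    have hmem : T.ncard ∈ {n | ∃ S : Set (Sym2 W), G.IsMitigating S ∧ S.ncard = n} :=
      ⟨T, ⟨hTS.trans hS, hT⟩, rfl⟩
    exact (Nat.sInf_le hmem).trans (Set.ncard_le_ncard hTS S.toFinite)
  induction S, S.toFinite using Set.Finite.induction_on with
  | empty => simp at hlt
  | @insert e T _ _ ih =>
    have hTU := Set.subset_insert e T
    have hmem : ∀ z ∈ insert e T, z ≠ e → z ∈ T := fun z hz hne => hz.resolve_left hne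
    generalize insert e T = U at *
    by_cases h : (G.deleteEdges T).maxDegree < G.maxDegree
    · obtain ⟨Z, hZ, h'⟩ := ih (hTU.trans hS) h
      exact ⟨Z, hZ.trans hTU, h'⟩
    · refine ⟨_, subset_rfl, le_antisymm (by omega) ?_⟩
      have : Nonempty W := by
        by_contra hW
        rw [not_nonempty_iff] at hW
        simp at hlt
      obtain ⟨v, hv⟩ := (G.deleteEdges T).exists_maximal_degree_vertex
      have h1 := (G.deleteEdges U).degree_le_maxDegree v
      have h2 : (G.deleteEdges T).degree v ≤ (G.deleteEdges U).degree v + 1 := by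
        simp only [← card_neighborFinset_eq_degree]
        by_cases hve : v ∈ e
        · obtain ⟨x, rfl⟩ := hve
          refine le_trans (card_le_card fun w hw => ?_) (card_insert_le x _)
          simp only [mem_neighborFinset, mem_insert, deleteEdges_adj] at hw ⊢
          by_cases hwx : w = x
          · exact .inl hwx
          · exact .inr ⟨hw.1, fun h' => hw.2 (hmem _ h' (mt Sym2.congr_right.1 hwx))⟩
        · refine le_trans (card_le_card fun w hw => ?_) (Nat.le_succ _)
          simp only [mem_neighborFinset, deleteEdges_adj] at hw ⊢
          refine ⟨hw.1, fun h' => hw.2 (hmem _ h' ?_)⟩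
          rintro rfl
          exact hve (Sym2.mem_mk_left _ _)
      omega

theorem Subgraph.IsPerfectMatching.two_mul_ncard_edgeSet_le {X : Type*} [Fintype X]
    {H : SimpleGraph X} {P : H.Subgraph} (hP : P.IsPerfectMatching) :
    2 * P.edgeSet.ncard ≤ Fintype.card X := by
  rw [Subgraph.isPerfectMatching_iff] at hP
  choose p hp hu using hP
  have h1 : 2 * #(univ.image fun x => s(x, p x)) ≤ #(univ : Finset X) := by
    refine mul_card_image_le_card (f := fun x => s(x, p x)) _ 2 fun z hz => ?_
    obtain ⟨x, -, rfl⟩ := mem_image.1 hz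
    have hpp : x = p (p x) := hu _ _ (hp x).symm
    rw [← card_pair (a := x) (b := p x) (hp x).ne]
    refine card_le_card fun y hy => ?_
    obtain rfl | rfl := mem_insert.1 hy |>.imp_right mem_singleton.1
    · simp
    · simp [← hpp]
  have h2 : P.edgeSet.ncard ≤ #(univ.image fun x => s(x, p x)) := by
    rw [← Set.ncard_coe_finset]
    refine Set.ncard_le_ncard ?_ (finite_toSet _)
    rintro ⟨a, b⟩ hab
    have hab : P.Adj a b := hab
    simp only [coe_image, coe_univ, Set.image_univ, Set.mem_range]
    exact ⟨a, by rw [← hu a b hab]⟩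
  rw [card_univ] at h1
  omega

/-- The graph obtained from `G` by joining every vertex outside `M`, together with `d` new
vertices, to all other vertices. -/
def universalExtension {W : Type*} (G : SimpleGraph W) (M : Set W) (d : ℕ) :
    SimpleGraph (W ⊕ Fin d) where
  Adj x y := x ≠ y ∧ ∀ u ∈ M, ∀ v ∈ M, x = .inl u → y = .inl v → G.Adj u v
  symm := ⟨fun _ _ h => ⟨h.1.symm, fun u hu v hv hx hy => (h.2 v hv u hu hy hx).symm⟩⟩
  loopless := ⟨fun _ h => h.1 rfl⟩

theorem two_mul_esDelta_le_of_isPerfectMatching {W : Type*} [Fintype W] {G : SimpleGraph W}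
    (hpos : 0 < G.maxDegree) {M : Set W} (hM : ∀ v, G.degree v = G.maxDegree ↔ v ∈ M) {d : ℕ}
    {P : (G.universalExtension M d).Subgraph} (hP : P.IsPerfectMatching) :
    2 * G.esDelta ≤ Fintype.card W + d := by
  have hne : Nonempty W := by
    by_contra hW
    rw [not_nonempty_iff] at hW
    simp at hpos
  have hnb : ∀ v ∈ M, ∃ w, G.Adj v w := fun v hv => by
    rw [← G.degree_pos_iff_exists_adj, (hM v).2 hv]
    exact hpos
  have hedge : ∀ z : Sym2 (W ⊕ Fin d), ∃ e ∈ G.edgeSet,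
      z ∈ P.edgeSet → ∀ v ∈ M, .inl v ∈ z → v ∈ e := by
    rintro ⟨a, b⟩
    by_cases hab : P.Adj a b
    · by_cases ha : ∃ u ∈ M, a = .inl u
      · obtain ⟨u, hu, rfl⟩ := ha
        by_cases hb : ∃ w ∈ M, b = .inl w
        · obtain ⟨w, hw, rfl⟩ := hb
          refine ⟨s(u, w), hab.adj_sub.2 u hu w hw rfl rfl, fun _ v _ hv => ?_⟩
          simpa using hv
        · obtain ⟨w, hw⟩ := hnb u hu
          refine ⟨s(u, w), hw, fun _ v hvM hv => ?_⟩
          obtain h | h := Sym2.mem_iff.1 hv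
          · simp [Sum.inl_injective h]
          · exact absurd ⟨v, hvM, h.symm⟩ hb
      · by_cases hb : ∃ w ∈ M, b = .inl w
        · obtain ⟨u, hu, rfl⟩ := hb
          obtain ⟨w, hw⟩ := hnb u hu
          refine ⟨s(u, w), hw, fun _ v hvM hv => ?_⟩
          obtain h | h := Sym2.mem_iff.1 hv
          · exact absurd ⟨v, hvM, h.symm⟩ ha
          · simp [Sum.inl_injective h]
        · obtain ⟨u, hu⟩ := G.exists_maximal_degree_vertex
          obtain ⟨w, hw⟩ := hnb u ((hM u).1 hu.symm)
          refine ⟨s(u, w), hw, fun _ v hvM hv => ?_⟩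
          obtain h | h := Sym2.mem_iff.1 hv
          · exact absurd ⟨v, hvM, h.symm⟩ ha
          · exact absurd ⟨v, hvM, h.symm⟩ hb
    · obtain ⟨u, hu⟩ := G.exists_maximal_degree_vertex
      obtain ⟨w, hw⟩ := hnb u ((hM u).1 hu.symm)
      exact ⟨s(u, w), hw, fun h => absurd h hab⟩
  choose F hFG hF using hedge
  have hS : F '' P.edgeSet ⊆ G.edgeSet := by
    rintro _ ⟨z, -, rfl⟩
    exact hFG z
  have hcover : ∀ v ∈ M, ∃ e ∈ F '' P.edgeSet, v ∈ e := by
    intro v hv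
    obtain ⟨y, hy, -⟩ := Subgraph.isPerfectMatching_iff.1 hP (.inl v)
    exact ⟨_, ⟨s(.inl v, y), hy, rfl⟩, hF _ hy v hv (Sym2.mem_mk_left _ _)⟩
  have hlt : (G.deleteEdges (F '' P.edgeSet)).maxDegree < G.maxDegree := by
    obtain ⟨v, hv⟩ := (G.deleteEdges (F '' P.edgeSet)).exists_maximal_degree_vertex
    rw [hv]
    by_cases hvM : v ∈ M
    · rw [← (hM v).2 hvM]
      obtain ⟨e, he, hve⟩ := hcover v hvM
      obtain ⟨w, rfl⟩ := hve
      simp only [← card_neighborFinset_eq_degree]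
      refine card_lt_card (ssubset_iff_of_subset (fun x hx => ?_) |>.2 ⟨w, ?_, ?_⟩)
      · simp only [mem_neighborFinset, deleteEdges_adj] at hx ⊢
        exact hx.1
      · simpa using hS he
      · simp only [mem_neighborFinset, deleteEdges_adj]
        exact fun h => h.2 he
    · exact (degree_le_of_le (deleteEdges_le _)).trans_lt
        (lt_of_le_of_ne (G.degree_le_maxDegree v) (hvM ∘ (hM v).1))
  have h1 := esDelta_le_ncard hS hlt
  have h2 := Set.ncard_image_le (f := F) P.edgeSet.toFinite
  have h3 := hP.two_mul_ncard_edgeSet_le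
  rw [Fintype.card_sum, Fintype.card_fin] at h3
  omega

theorem Connected.exists_isPerfectMatching_universalExtension {W : Type*} [Fintype W]
    {G : SimpleGraph W} (hG : G.Connected) {d : ℕ} (hd : Fintype.card W < 9 * d)
    (heven : Even (Fintype.card W + d)) :
    ∃ P : (G.universalExtension {v | G.degree v = G.maxDegree} d).Subgraph,
      P.IsPerfectMatching := by
  set M : Set W := {v | G.degree v = G.maxDegree} with hM
  rw [tutte]
  intro T hT
  set K := ((⊤ : (G.universalExtension M d).Subgraph).deleteVerts T).coe with hK
  have hT : T.ncard < K.oddComponents.ncard := hT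
  have hverts : ∀ x, x ∈ ((⊤ : (G.universalExtension M d).Subgraph).deleteVerts T).verts ↔
      x ∉ T := by simp
  have hKadj : ∀ x y, K.Adj x y ↔ (G.universalExtension M d).Adj x.1 y.1 := by
    intro x y
    have hx := (hverts _).1 x.2
    have hy := (hverts _).1 y.2
    simp [hK, hx, hy]
  by_cases huniv : ∃ x, x ∉ T ∧ ∀ u ∈ M, x ≠ .inl u
  · obtain ⟨x, hxT, hx⟩ := huniv
    have hpre : K.Preconnected := by
      have h : ∀ y, K.Reachable ⟨x, (hverts x).2 hxT⟩ y := by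
        intro y
        by_cases hxy : x = y.1
        · subst hxy
          exact Reachable.refl _
        · exact ((hKadj _ _).2 ⟨hxy, fun u hu _ _ h _ => absurd h (hx u hu)⟩).reachable
      exact fun y z => (h y).symm.trans (h z)
    have := hpre.subsingleton_connectedComponent
    have h1 : K.oddComponents.ncard ≤ 1 := Set.ncard_le_one_of_subsingleton _
    have hT0 : T = ∅ := (Set.ncard_eq_zero T.toFinite).1 (by omega)
    have hodd : Odd K.oddComponents.ncard := by
      rw [show K.oddComponents.ncard = 1 by omega]
      exact odd_one
    rw [odd_ncard_oddComponents, Nat.card_congr (Equiv.subtypeUnivEquiv fun y => (hverts y).2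
      (by simp [hT0])), Nat.card_eq_fintype_card, Fintype.card_sum, Fintype.card_fin] at hodd
    exact Nat.not_odd_iff_even.2 heven hodd
  · push Not at huniv
    have hinr : ∀ i, (.inr i : W ⊕ Fin d) ∈ T := fun i => by
      by_contra h
      obtain ⟨u, -, hu⟩ := huniv _ h
      cases hu
    have hinl : ∀ v, (.inl v : W ⊕ Fin d) ∉ T → v ∈ M := fun v h => by
      obtain ⟨u, hu, h⟩ := huniv _ h
      rwa [Sum.inl_injective h]
    let R : Finset W := {w | .inl w ∈ T}
    have hmemR : ∀ v, v ∈ R ↔ .inl v ∈ T := by simp [R]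
    have hTcard : T.ncard = #R + d := by
      have : T = ((R.disjSum univ : Finset (W ⊕ Fin d)) : Set (W ⊕ Fin d)) := by
        ext (v | i)
        · simp [hmemR]
        · simp [hinr]
      rw [this, Set.ncard_coe_finset, card_disjSum, card_univ, Fintype.card_fin]
    have hnonempty : Nonempty K.ConnectedComponent := by
      obtain ⟨c, -⟩ := (Set.ncard_pos K.oddComponents.toFinite).1 (by omega)
      exact ⟨c⟩
    let f : W → K.ConnectedComponent := fun v =>
      if h : .inl v ∉ T then K.connectedComponentMk ⟨.inl v, (hverts _).2 h⟩
      else Classical.arbitrary _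
    have hfmk : ∀ v (h : .inl v ∉ T), f v = K.connectedComponentMk ⟨.inl v, (hverts _).2 h⟩ :=
      fun v h => dif_pos h
    have hmain := hG.nine_mul_card_odd_le R
      (fun v hv => hinl v fun h => hv ((hmemR v).2 h)) f ?_ ?_
    · have hle : K.oddComponents.ncard ≤ #{c | Odd #{v | v ∉ R ∧ f v = c}} := by
        rw [← Set.ncard_coe_finset]
        refine Set.ncard_le_ncard (fun c hc => ?_) (finite_toSet _)
        have hc : Odd c.supp.ncard := hc
        have himg : Subtype.val '' c.supp =
            Sum.inl '' (({v | v ∉ R ∧ f v = c} : Finset W) : Set W) := by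
          ext x
          constructor
          · rintro ⟨⟨x, hx⟩, hxc, rfl⟩
            have hxT := (hverts x).1 hx
            obtain ⟨v, -, rfl⟩ := huniv x hxT
            refine ⟨v, ?_, rfl⟩
            simp only [coe_filter, mem_univ, true_and, Set.mem_ofPred_eq, hmemR]
            exact ⟨hxT, (hfmk v hxT).trans hxc⟩
          · rintro ⟨v, hv, rfl⟩
            simp only [coe_filter, mem_univ, true_and, Set.mem_ofPred_eq, hmemR] at hv
            exact ⟨⟨.inl v, (hverts _).2 hv.1⟩, (hfmk v hv.1).symm.trans hv.2, rfl⟩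
        rw [← Set.ncard_image_of_injective _ Subtype.val_injective, himg,
          Set.ncard_image_of_injective _ Sum.inl_injective, Set.ncard_coe_finset] at hc
        simpa using hc
      omega
    · intro c
      induction c using ConnectedComponent.ind with
      | h x =>
        obtain ⟨x, hx⟩ := x
        have hxT := (hverts x).1 hx
        obtain ⟨v, -, rfl⟩ := huniv x hxT
        exact ⟨v, fun h => hxT ((hmemR v).1 h), hfmk v hxT⟩
    · intro u v hu hv huv
      rw [hmemR] at hu hv
      rw [hfmk u hu, hfmk v hv]
      refine ConnectedComponent.eq.2 (Adj.reachable ((hKadj _ _).2 ⟨?_, ?_⟩))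
      · exact fun h => huv.ne (Sum.inl_injective h)
      · rintro a - b - ha hb
        rwa [← Sum.inl_injective ha, ← Sum.inl_injective hb]

end SimpleGraph

/-- For every `ε > 0` and all sufficiently large `n`, every connected graph of order `n`
with at least one edge satisfies `es_Δ(G) ≤ (5/9 + ε)·n`. -/
theorem stmt_14 :
    ∀ ε : ℝ, 0 < ε → ∃ N : ℕ, ∀ (W : Type u) [Fintype W] (G : SimpleGraph W),
      N ≤ Fintype.card W → G.Connected → G.edgeSet.Nonempty →
      (G.esDelta : ℝ) ≤ (5 / 9 + ε) * Fintype.card W := by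
  intro ε hε
  obtain ⟨N, hN⟩ := exists_nat_gt (1 / ε)
  refine ⟨N, fun W _ G hcard hG hne => ?_⟩
  have hpos : 0 < G.maxDegree := by
    obtain ⟨⟨u, v⟩, huv⟩ := hne
    exact ((G.degree_pos_iff_exists_adj u).2 ⟨v, huv⟩).trans_le (G.degree_le_maxDegree u)
  obtain ⟨d, hd1, hd2, heven⟩ : ∃ d, Fintype.card W < 9 * d ∧ 9 * d ≤ Fintype.card W + 18 ∧
      Even (Fintype.card W + d) := by
    obtain h | h := Nat.even_or_odd (Fintype.card W + (Fintype.card W / 9 + 1))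
    · exact ⟨_, by omega, by omega, h⟩
    · exact ⟨Fintype.card W / 9 + 2, by omega, by omega, h.add_one⟩
  obtain ⟨P, hP⟩ := hG.exists_isPerfectMatching_universalExtension hd1 heven
  have h1 : 9 * G.esDelta ≤ 5 * Fintype.card W + 9 := by
    have := two_mul_esDelta_le_of_isPerfectMatching hpos (fun _ => Iff.rfl) hP
    omega
  have h2 : (9 : ℝ) * G.esDelta ≤ 5 * Fintype.card W + 9 := by exact_mod_cast h1
  have h3 : 1 ≤ ε * Fintype.card W := by
    rw [div_lt_iff₀ hε, mul_comm] at hN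
    exact hN.le.trans (by gcongr)
  linarith
end

section
/- If G is a bipartite finite simple graph of order n with at least one edge, then es_Δ(G) ≤ n/2. -/
open SimpleGraph

attribute [local instance] Classical.propDecidable

universe u

variable {V : Type u}

/-- A symmetric matrix of natural numbers with constant positive row
sums has a permutation supported on its nonzero entries. -/
theorem exists_perm_of_symm_of_row_sum [Fintype V] (w : V → V → ℕ) (d : ℕ) (hd : 0 < d)
    (hsymm : ∀ u v, w u v = w v u) (hsum : ∀ v, ∑ u, w v u = d) :
    ∃ σ : Equiv.Perm V, ∀ v, w v (σ v) ≠ 0 := by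
  have hall := (Finset.all_card_le_biUnion_card_iff_exists_injective
    (fun v => Finset.univ.filter (fun u => w v u ≠ 0))).1 (by
      intro s
      set T := s.biUnion (fun v => Finset.univ.filter (fun u => w v u ≠ 0)) with hT
      refine Nat.le_of_mul_le_mul_right ?_ hd
      calc s.card * d = ∑ v ∈ s, ∑ u, w v u := by simp [hsum]
        _ = ∑ v ∈ s, ∑ u ∈ T, w v u := by
          refine Finset.sum_congr rfl fun v hv => ?_
          refine (Finset.sum_subset (Finset.subset_univ T) fun u _ hu => ?_).symm
          by_contra h
          exact hu (Finset.mem_biUnion.2 ⟨v, hv, by simpa using h⟩)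
        _ = ∑ u ∈ T, ∑ v ∈ s, w v u := Finset.sum_comm
        _ ≤ ∑ u ∈ T, ∑ v, w v u :=
          Finset.sum_le_sum fun u _ => Finset.sum_le_sum_of_subset (Finset.subset_univ s)
        _ = T.card * d := by simp [hsymm _, hsum])
  obtain ⟨f, hf, hmem⟩ := hall
  exact ⟨Equiv.ofBijective f (Finite.injective_iff_bijective.1 hf),
    fun v => by simpa using hmem v⟩

/-- Every graph with an edge has a permutation of its vertices that moves each vertex to a
neighbor or fixes it, fixing only vertices of non-maximum degree. -/
theorem SimpleGraph.exists_perm_adj_or_degree_lt [Fintype V] (G : SimpleGraph V)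
    (hΔ : 0 < G.maxDegree) :
    ∃ σ : Equiv.Perm V, ∀ v, G.Adj v (σ v) ∨ σ v = v ∧ G.degree v < G.maxDegree := by
  obtain ⟨σ, hσ⟩ := exists_perm_of_symm_of_row_sum
    (fun v u => (if G.Adj v u then 1 else 0) + if u = v then G.maxDegree - G.degree v else 0)
    G.maxDegree hΔ
    (by
      intro u v
      by_cases h : u = v
      · rw [h]
      · simp [h, Ne.symm h, G.adj_comm])
    (by
      intro v
      have h := G.degree_le_maxDegree v
      have hdeg : (∑ u, if G.Adj v u then 1 else 0) = G.degree v := by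
        rw [← Finset.card_filter, ← G.neighborFinset_eq_filter, G.card_neighborFinset_eq_degree]
      rw [Finset.sum_add_distrib, hdeg, Finset.sum_ite_eq' Finset.univ v]
      simp only [Finset.mem_univ, if_true]
      omega)
  refine ⟨σ, fun v => ?_⟩
  have h := hσ v
  by_cases hadj : G.Adj v (σ v)
  · exact Or.inl hadj
  · right
    by_cases hv : σ v = v
    · simp only [hv, if_true] at h
      refine ⟨hv, ?_⟩
      simp at h
      omega
    · simp [hadj, hv] at h

/-- Either side of a bipartition bounds the Δ-edge stability number. -/
theorem SimpleGraph.esDelta_le_card_color_class [Fintype V] (G : SimpleGraph V)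
    (hΔ : 0 < G.maxDegree) (c : V → Prop) (hc : ∀ u v, G.Adj u v → (c u ↔ ¬ c v)) :
    G.esDelta ≤ (Finset.univ.filter c).card := by
  obtain ⟨σ, hσ⟩ := G.exists_perm_adj_or_degree_lt hΔ
  set S : Set (Sym2 V) := {e | ∃ v, c v ∧ G.Adj v (σ v) ∧ e = s(v, σ v)}
  have hmax : ∀ v, G.degree v = G.maxDegree → ∃ u, s(v, u) ∈ S := by
    intro v hv
    by_cases hcv : c v
    · exact ⟨σ v, v, hcv, (hσ v).resolve_right (fun h => by omega), rfl⟩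
    · have hadj : G.Adj (σ.symm v) v := by
        rcases hσ (σ.symm v) with h | ⟨h, hlt⟩
        · simpa using h
        · rw [Equiv.apply_symm_apply] at h
          rw [← h] at hlt
          omega
      exact ⟨σ.symm v, σ.symm v, (hc _ _ hadj).2 hcv, by simpa using hadj, by
        simp [Sym2.eq_swap]⟩
  have huniq : ∀ v, ∃ u, ∀ x, s(v, x) ∈ S → x = u := by
    intro v
    refine ⟨if c v then σ v else σ.symm v, ?_⟩
    rintro x ⟨y, hy, hadj, he⟩
    have hcy := (hc _ _ hadj).1 hy
    rcases Sym2.eq_iff.1 he with ⟨rfl, rfl⟩ | ⟨rfl, rfl⟩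
    · simp [hy]
    · simp [hcy]
  have hsub : S ⊆ G.edgeSet := by
    rintro e ⟨v, -, hadj, rfl⟩
    exact hadj
  have hcard : S.ncard ≤ (Finset.univ.filter c).card := by
    have hle : S ⊆ ((Finset.univ.filter c).image (fun v => s(v, σ v)) : Finset (Sym2 V)) := by
      rintro e ⟨v, hv, -, rfl⟩
      simp only [Finset.coe_image]
      exact ⟨v, by simpa using hv, rfl⟩
    refine (Set.ncard_le_ncard hle (Finset.finite_toSet _)).trans ?_
    rw [Set.ncard_coe_finset]
    exact Finset.card_image_le
  clear_value S
  refine le_trans (Nat.sInf_le ⟨S, ⟨hsub, le_antisymm ?_ ?_⟩, rfl⟩) hcard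
  · refine maxDegree_le_of_forall_degree_le _ _ fun v => ?_
    have hle : (G.deleteEdges S).neighborFinset v ⊆ G.neighborFinset v := by
      intro x
      simp only [mem_neighborFinset, deleteEdges_adj]
      exact And.left
    have hdeg := G.degree_le_maxDegree v
    by_cases hv : G.degree v = G.maxDegree
    · obtain ⟨u, hu⟩ := hmax v hv
      have hlt := Finset.card_lt_card (Finset.ssubset_iff_subset_ne.2 ⟨hle, fun h => by
        have hmem : u ∈ G.neighborFinset v := (G.mem_neighborFinset v u).2 (hsub hu)
        rw [← h, mem_neighborFinset, deleteEdges_adj] at hmem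
        exact hmem.2 hu⟩)
      simp only [card_neighborFinset_eq_degree] at hlt
      omega
    · have := Finset.card_le_card hle
      simp only [card_neighborFinset_eq_degree] at this
      omega
  · have : Nonempty V := by
      by_contra h
      rw [not_nonempty_iff] at h
      simp at hΔ
    obtain ⟨v, hv⟩ := G.exists_maximal_degree_vertex
    obtain ⟨u, hu⟩ := huniq v
    have hle : G.neighborFinset v ⊆ insert u ((G.deleteEdges S).neighborFinset v) := by
      intro x hx
      simp only [Finset.mem_insert, mem_neighborFinset, deleteEdges_adj] at hx ⊢
      by_cases h : s(v, x) ∈ S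
      · exact Or.inl (hu x h)
      · exact Or.inr ⟨hx, h⟩
    have h := (Finset.card_le_card hle).trans (Finset.card_insert_le _ _)
    have h' := (G.deleteEdges S).degree_le_maxDegree v
    simp only [card_neighborFinset_eq_degree] at h
    omega

/-- For a bipartite graph of order `n` with at least one edge, `es_Δ(G) ≤ n/2`. -/
theorem stmt_15 [Fintype V] (G : SimpleGraph V) (hE : G.edgeSet.Nonempty)
    (hbip : G.Colorable 2) :
    (G.esDelta : ℝ) ≤ (Fintype.card V : ℝ) / 2 := by
  obtain ⟨C⟩ := hbip
  have hΔ : 0 < G.maxDegree := by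
    obtain ⟨e, he⟩ := hE
    induction e using Sym2.ind with
    | _ u v =>
      exact ((G.degree_pos_iff_exists_adj u).2 ⟨v, he⟩).trans_le (G.degree_le_maxDegree u)
  obtain ⟨c, hc⟩ : ∃ c : V → Prop, ∀ v, c v ↔ C v = 0 := ⟨fun v => C v = 0, fun _ => Iff.rfl⟩
  have hne : ∀ u v, G.Adj u v → (c u ↔ ¬ c v) := fun u v h => by
    have := C.valid h
    rw [hc, hc]
    omega
  have h₁ := G.esDelta_le_card_color_class hΔ c hne
  have h₂ : G.esDelta ≤ (Finset.univ.filter fun v => ¬ c v).card := by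
    convert G.esDelta_le_card_color_class hΔ (fun v => ¬ c v) fun u v h =>
      not_congr (hne u v h)
  have hsum : (Finset.univ.filter c).card + (Finset.univ.filter fun v => ¬ c v).card =
      (Finset.univ : Finset V).card := by
    exact Finset.card_filter_add_card_filter_not (s := (Finset.univ : Finset V)) c
  rw [Finset.card_univ] at hsum
  have h : 2 * G.esDelta ≤ Fintype.card V := by omega
  have h' : (2 : ℝ) * G.esDelta ≤ Fintype.card V := by exact_mod_cast h
  linarith
end

section
/- Let G be a finite simple graph with at least one edge and maximum degree Δ = Δ(G). If the subgraph of G induced by core(G) admits a proper edge coloring with Δ colors (i.e., an assignment of colors from a set of size Δ to its edges so that adjacent edges receive distinct colors), then G has a matching that saturates core(G). -/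
open SimpleGraph

attribute [local instance] Classical.propDecidable

universe u

variable {V : Type u}

/-- The core of `G`: the set of vertices of maximum degree. -/
def SimpleGraph.core [Fintype V] (G : SimpleGraph V) : Set V :=
  {v | G.degree v = G.maxDegree}

/-- `H` has a proper `k`-edge coloring: the edges of `H` can be colored with `k` colors
so that any two distinct edges sharing an endpoint receive distinct colors. -/
def SimpleGraph.HasProperEdgeColoring {W : Type u} (H : SimpleGraph W) (k : ℕ) : Prop :=
  ∃ c : Sym2 W → ℕ, (∀ e ∈ H.edgeSet, c e < k) ∧
    ∀ e ∈ H.edgeSet, ∀ f ∈ H.edgeSet, e ≠ f → (∃ v, v ∈ e ∧ v ∈ f) → c e ≠ c f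

namespace SimpleGraph

/-- If the edges inside an odd set `Q` of vertices of degree `D` are properly colored with `D`
colors, then at least `D` edges leave `Q`. -/
theorem le_sum_card_neighborFinset_sdiff [Fintype V] (F : SimpleGraph V) {D : ℕ} {Q : Finset V}
    (hdeg : ∀ v ∈ Q, F.degree v = D) (c : V → V → ℕ) (hsymm : ∀ v w, c v w = c w v)
    (hlt : ∀ v ∈ Q, ∀ w ∈ Q, F.Adj v w → c v w < D)
    (hinj : ∀ v ∈ Q, ∀ x ∈ Q, ∀ y ∈ Q, F.Adj v x → F.Adj v y → c v x = c v y → x = y)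
    (hodd : Odd Q.card) :
    D ≤ ∑ v ∈ Q, (F.neighborFinset v \ Q).card := by
  let H : ℕ → SimpleGraph V := fun k =>
    { Adj := fun v w => F.Adj v w ∧ v ∈ Q ∧ w ∈ Q ∧ c v w = k
      symm := ⟨fun v w h => ⟨h.1.symm, h.2.2.1, h.2.1, by rw [hsymm, h.2.2.2]⟩⟩
      loopless := ⟨fun v h => F.loopless.irrefl v h.1⟩ }
  have hH1 : ∀ k, ∀ v ∈ Q, (H k).degree v ≤ 1 := by
    intro k v hv
    rw [← card_neighborFinset_eq_degree, Finset.card_le_one]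
    intro x hx y hy
    rw [mem_neighborFinset] at hx hy
    exact hinj v hv x hx.2.2.1 y hy.2.2.1 hx.1 hy.1 (hx.2.2.2.trans hy.2.2.2.symm)
  have hH0 : ∀ k, ∀ v ∉ Q, (H k).degree v = 0 := by
    intro k v hv
    rw [← card_neighborFinset_eq_degree, Finset.card_eq_zero, Finset.eq_empty_iff_forall_notMem]
    intro x hx
    rw [mem_neighborFinset] at hx
    exact hv hx.2.1
  have hH : ∀ k, ∑ v ∈ Q, (H k).degree v ≤ Q.card - 1 := by
    intro k
    have h1 : ∑ v ∈ Q, (H k).degree v = 2 * (H k).edgeFinset.card := by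
      rw [← sum_degrees_eq_twice_card_edges]
      exact Finset.sum_subset (Finset.subset_univ _) fun v _ hv => hH0 k v hv
    have h2 : ∑ v ∈ Q, (H k).degree v ≤ Q.card := by
      simpa using Finset.sum_le_sum (hH1 k)
    obtain ⟨m, hm⟩ := hodd
    omega
  have hin : ∀ v ∈ Q, (F.neighborFinset v ∩ Q).card = ∑ k ∈ Finset.range D, (H k).degree v := by
    intro v hv
    rw [Finset.card_eq_sum_card_fiberwise (f := c v) (t := Finset.range D)]
    · refine Finset.sum_congr rfl fun k _ => ?_
      rw [← card_neighborFinset_eq_degree]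
      congr 1
      ext w
      simp only [Finset.mem_filter, Finset.mem_inter, mem_neighborFinset, H]
      tauto
    · intro w hw
      simp only [Finset.coe_inter, Set.mem_inter_iff, Finset.mem_coe, mem_neighborFinset] at hw
      simpa using hlt v hv w hw.2 hw.1
  have htot : ∑ v ∈ Q, (F.neighborFinset v ∩ Q).card ≤ D * (Q.card - 1) := by
    rw [Finset.sum_congr rfl hin, Finset.sum_comm]
    simpa using Finset.sum_le_sum fun k (_ : k ∈ Finset.range D) => hH k
  have hsum : ∑ v ∈ Q, (F.neighborFinset v \ Q).card + ∑ v ∈ Q, (F.neighborFinset v ∩ Q).card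
      = Q.card * D := by
    rw [← Finset.sum_add_distrib, ← smul_eq_mul, ← Finset.sum_const]
    refine Finset.sum_congr rfl fun v hv => ?_
    rw [Finset.card_sdiff_add_card_inter, card_neighborFinset_eq_degree, hdeg v hv]
  obtain ⟨m, hm⟩ := hodd
  have h3 : Q.card - 1 = 2 * m := by omega
  rw [h3] at htot
  rw [hm] at hsum
  nlinarith

/-- Disjoint vertex sets which each send at least `D` edges to `u`, and no edge elsewhere outside
themselves, are at most `u.card` many when degrees are at most `D`. -/
theorem card_le_card_of_le_sum_card_neighborFinset_sdiff [Fintype V] (F : SimpleGraph V) {D : ℕ}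
    (hD : 0 < D) (hdeg : ∀ v, F.degree v ≤ D) {ι : Type*} (s : Finset ι) (Q : ι → Finset V)
    (u : Finset V) (hdisj : (s : Set ι).PairwiseDisjoint Q)
    (hnbr : ∀ i ∈ s, ∀ v ∈ Q i, F.neighborFinset v \ Q i ⊆ u)
    (hout : ∀ i ∈ s, D ≤ ∑ v ∈ Q i, (F.neighborFinset v \ Q i).card) :
    s.card ≤ u.card := by
  refine Nat.le_of_mul_le_mul_right ?_ hD
  calc s.card * D ≤ ∑ i ∈ s, ∑ v ∈ Q i, (F.neighborFinset v \ Q i).card := by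
        simpa using Finset.sum_le_sum hout
    _ ≤ ∑ i ∈ s, ∑ v ∈ Q i, (u.filter (F.Adj v)).card := by
        refine Finset.sum_le_sum fun i hi => Finset.sum_le_sum fun v hv =>
          Finset.card_le_card fun w hw => ?_
        refine Finset.mem_filter.2 ⟨hnbr i hi v hv hw, ?_⟩
        simpa using (Finset.mem_sdiff.1 hw).1
    _ = ∑ v ∈ s.biUnion Q, (u.filter (F.Adj v)).card := (Finset.sum_biUnion hdisj).symm
    _ ≤ ∑ v, (u.filter (F.Adj v)).card :=
        Finset.sum_le_sum_of_subset (Finset.subset_univ _)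
    _ = ∑ w ∈ u, (Finset.univ.filter (F.Adj · w)).card :=
        Finset.sum_card_bipartiteAbove_eq_sum_card_bipartiteBelow F.Adj
    _ ≤ ∑ w ∈ u, D := by
        refine Finset.sum_le_sum fun w _ => le_trans (le_of_eq ?_) (hdeg w)
        rw [← card_neighborFinset_eq_degree]
        congr 1
        ext v
        simp [F.adj_comm]
    _ = u.card * D := by simp

/-- A Berge type consequence of Tutte's theorem on matchings saturating a set `A`. -/
theorem exists_isMatching_or_exists_odd_sets [Fintype V] (F : SimpleGraph V)
    (hV : Even (Fintype.card V)) (A : Set V) :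
    (∃ M : F.Subgraph, M.IsMatching ∧ A ⊆ M.verts) ∨
    ∃ (u : Finset V) (𝒬 : Finset (Finset V)), u.card < 𝒬.card ∧
      (𝒬 : Set (Finset V)).PairwiseDisjoint id ∧
      ∀ Q ∈ 𝒬, Odd Q.card ∧ (Q : Set V) ⊆ A ∧ ∀ v ∈ Q, F.neighborFinset v \ Q ⊆ u := by
  let K : SimpleGraph V := F ⊔ fromRel fun v w => v ∉ A ∧ w ∉ A
  have hKA : ∀ v w, K.Adj v w → v ∈ A ∨ w ∈ A → F.Adj v w := by
    intro v w h hA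
    simp only [K, sup_adj, fromRel_adj] at h
    tauto
  by_cases hK : ∃ M : K.Subgraph, M.IsPerfectMatching
  · obtain ⟨M, hM⟩ := hK
    rw [Subgraph.isPerfectMatching_iff] at hM
    refine .inl ⟨
      { verts := {v | ∃ w, M.Adj v w ∧ (v ∈ A ∨ w ∈ A)}
        Adj := fun v w => M.Adj v w ∧ (v ∈ A ∨ w ∈ A)
        adj_sub := fun h => hKA _ _ h.1.adj_sub h.2
        edge_vert := fun {v w} h => ⟨w, h⟩
        symm := ⟨fun v w h => ⟨h.1.symm, h.2.symm⟩⟩ }, ?_, ?_⟩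
    · rintro v ⟨w, hw⟩
      exact ⟨w, hw, fun y hy => (hM v).unique hy.1 hw.1⟩
    · intro v hv
      obtain ⟨w, hw, -⟩ := hM v
      exact ⟨w, hw, .inl hv⟩
  · rw [tutte] at hK
    push Not at hK
    obtain ⟨u, hu⟩ := hK
    rw [IsTutteViolator] at hu
    set L := ((⊤ : K.Subgraph).deleteVerts u).coe with hL
    have hpar := L.odd_ncard_oddComponents
    have hcard : Nat.card ((⊤ : K.Subgraph).deleteVerts u).verts + u.ncard = Fintype.card V := by
      rw [Nat.card_coe_set_eq, Subgraph.deleteVerts_verts, Subgraph.verts_top,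
        ← Set.compl_eq_univ_sdiff, add_comm, Set.ncard_add_ncard_compl, Nat.card_eq_fintype_card]
    have hlt : u.ncard + 1 < L.oddComponents.ncard := by
      rw [Nat.odd_iff, Nat.odd_iff] at hpar
      rw [Nat.even_iff] at hV
      omega
    let S : L.ConnectedComponent → Finset V := fun C => (Subtype.val '' C.supp).toFinset
    have hmem : ∀ C v, v ∈ S C ↔ ∃ h, L.connectedComponentMk ⟨v, h⟩ = C := by
      intro C v
      simp [S]
    have hdisj : ∀ C C', C ≠ C' → Disjoint (S C) (S C') := by
      intro C C' hne
      rw [Finset.disjoint_left]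
      intro v h1 h2
      obtain ⟨h, h1⟩ := (hmem _ _).1 h1
      obtain ⟨h', h2⟩ := (hmem _ _).1 h2
      exact hne (h1.symm.trans h2)
    have hne : ∀ C, (S C).Nonempty := by
      intro C
      obtain ⟨v, hv⟩ := C.nonempty_supp
      exact ⟨v, (hmem _ _).2 ⟨v.2, hv⟩⟩
    have hinj : Function.Injective S := by
      intro C C' h
      by_contra hCC
      have := hdisj C C' hCC
      rw [h, Finset.disjoint_self_iff_empty] at this
      exact (hne C').ne_empty this
    have hSodd : ∀ C ∈ L.oddComponents, Odd (S C).card := by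
      intro C hC
      have : (S C).card = C.supp.ncard := by
        rw [← Set.ncard_image_of_injective _ Subtype.val_injective, Set.ncard_eq_toFinset_card']
      rw [this]
      exact hC
    have hadj : ∀ C, ∀ v ∈ S C, ∀ w, K.Adj v w → w ∉ u → w ∈ S C := by
      intro C v hv w hvw hw
      obtain ⟨h, hv⟩ := (hmem _ _).1 hv
      have hw' : w ∈ ((⊤ : K.Subgraph).deleteVerts u).verts := by simpa using hw
      refine (hmem _ _).2 ⟨hw', ?_⟩
      rw [← hv]
      refine (ConnectedComponent.connectedComponentMk_eq_of_adj ?_).symm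
      have hvu : v ∉ u := by simpa using h
      simpa [hL, hvu, hw] using hvw
    let O : Finset L.ConnectedComponent := L.oddComponents.toFinset
    have hOcard : O.card = L.oddComponents.ncard := by
      rw [Set.ncard_eq_toFinset_card']
    have hbad : (O.filter fun C => ¬ (S C : Set V) ⊆ A).card ≤ 1 := by
      rw [Finset.card_le_one]
      intro C hC C' hC'
      obtain ⟨v, hv, hvA⟩ := Set.not_subset.1 (Finset.mem_filter.1 hC).2
      obtain ⟨w, hw, hwA⟩ := Set.not_subset.1 (Finset.mem_filter.1 hC').2
      by_contra hCC
      have hd := Finset.disjoint_left.1 (hdisj C C' hCC)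
      have hwu : w ∉ u := by
        obtain ⟨h, -⟩ := (hmem _ _).1 hw
        simpa using h
      refine hd (hadj C v hv w ?_ hwu) hw
      have hvw : v ≠ w := by
        rintro rfl
        exact hd hv hw
      simp [K, hvw, hvA, hwA]
    have hsplit := Finset.card_filter_add_card_filter_not (s := O) fun C => (S C : Set V) ⊆ A
    refine .inr ⟨u.toFinset, (O.filter fun C => (S C : Set V) ⊆ A).image S, ?_, ?_, ?_⟩
    · rw [Finset.card_image_of_injective _ hinj, ← Set.ncard_eq_toFinset_card']
      omega
    · intro Q hQ Q' hQ' hQQ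
      obtain ⟨C, -, rfl⟩ := Finset.mem_image.1 (Finset.mem_coe.1 hQ)
      obtain ⟨C', -, rfl⟩ := Finset.mem_image.1 (Finset.mem_coe.1 hQ')
      exact hdisj C C' fun h => hQQ (by rw [h])
    · intro Q hQ
      obtain ⟨C, hC, rfl⟩ := Finset.mem_image.1 hQ
      obtain ⟨hC, hCA⟩ := Finset.mem_filter.1 hC
      refine ⟨hSodd C (by simpa [O] using hC), hCA, fun v hv w hw => ?_⟩
      rw [Finset.mem_sdiff, mem_neighborFinset] at hw
      rw [Set.mem_toFinset]
      by_contra hwu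
      exact hw.2 (hadj C v hv w (.inl hw.1) hwu)

/-- If `F` has an even number of vertices, degrees at most `D`, and the edges inside a set `A` of
vertices of degree `D` are properly colored with `D` colors, then some matching saturates `A`. -/
theorem exists_isMatching_of_edgeColoring_of_even_card [Fintype V] (F : SimpleGraph V)
    (hV : Even (Fintype.card V)) {D : ℕ} (hD : 0 < D) (hdeg : ∀ v, F.degree v ≤ D) (A : Set V)
    (hA : ∀ v ∈ A, F.degree v = D) (c : V → V → ℕ) (hsymm : ∀ v w, c v w = c w v)
    (hlt : ∀ v ∈ A, ∀ w ∈ A, F.Adj v w → c v w < D)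
    (hinj : ∀ v ∈ A, ∀ x ∈ A, ∀ y ∈ A, F.Adj v x → F.Adj v y → c v x = c v y → x = y) :
    ∃ M : F.Subgraph, M.IsMatching ∧ A ⊆ M.verts := by
  refine (F.exists_isMatching_or_exists_odd_sets hV A).resolve_right ?_
  rintro ⟨u, 𝒬, hlt', hdisj, h𝒬⟩
  refine hlt'.not_ge (F.card_le_card_of_le_sum_card_neighborFinset_sdiff hD hdeg 𝒬 id u hdisj
    (fun Q hQ => (h𝒬 Q hQ).2.2) fun Q hQ => ?_)
  obtain ⟨hodd, hQA, -⟩ := h𝒬 Q hQ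
  exact F.le_sum_card_neighborFinset_sdiff (fun v hv => hA v (hQA hv)) c hsymm
    (fun v hv w hw => hlt v (hQA hv) w (hQA hw))
    (fun v hv x hx y hy => hinj v (hQA hv) x (hQA hx) y (hQA hy)) hodd

end SimpleGraph

/-- If `G[core(G)]` has a proper `Δ(G)`-edge coloring, then `G` has a matching
saturating `core(G)`. -/
theorem stmt_16 [Fintype V] (G : SimpleGraph V) (hE : G.edgeSet.Nonempty)
    (hcol : (G.induce G.core).HasProperEdgeColoring G.maxDegree) :
    ∃ M : G.Subgraph, M.IsMatching ∧ G.core ⊆ M.verts := by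
  obtain ⟨F, hadj⟩ : ∃ F : SimpleGraph (V × Bool), ∀ x y, F.Adj x y ↔ G.Adj x.1 y.1 ∧ x.2 = y.2 :=
    ⟨{ Adj := fun x y => G.Adj x.1 y.1 ∧ x.2 = y.2
       symm := ⟨fun x y h => ⟨h.1.symm, h.2.symm⟩⟩
       loopless := ⟨fun x h => G.loopless.irrefl _ h.1⟩ }, fun _ _ => Iff.rfl⟩
  have hF : ∀ x, F.degree x = G.degree x.1 := by
    rintro ⟨v, b⟩
    have : F.neighborFinset (v, b) = (G.neighborFinset v).image fun w => (w, b) := by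
      ext ⟨w, b'⟩
      simp [hadj, eq_comm]
    rw [← card_neighborFinset_eq_degree, this,
      Finset.card_image_of_injective _ (Prod.mk_left_injective b), card_neighborFinset_eq_degree]
  have hD : 0 < G.maxDegree := by
    obtain ⟨e, he⟩ := hE
    induction e with
    | h v w => exact (G.degree_pos_iff_exists_adj v |>.2 ⟨w, he⟩).trans_le (G.degree_le_maxDegree v)
  obtain ⟨c, hlt, hc⟩ := hcol
  let c' : V → V → ℕ := fun v w =>
    if h : v ∈ G.core ∧ w ∈ G.core then c s(⟨v, h.1⟩, ⟨w, h.2⟩) else 0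
  have hc' : ∀ v w (hv : v ∈ G.core) (hw : w ∈ G.core), c' v w = c s(⟨v, hv⟩, ⟨w, hw⟩) :=
    fun v w hv hw => dif_pos ⟨hv, hw⟩
  have hsymm : ∀ v w, c' v w = c' w v := by
    intro v w
    by_cases h : v ∈ G.core ∧ w ∈ G.core
    · rw [hc' v w h.1 h.2, hc' w v h.2 h.1, Sym2.eq_swap]
    · rw [show c' v w = 0 from dif_neg h, show c' w v = 0 from dif_neg fun h' => h h'.symm]
  obtain ⟨M, hM, hAM⟩ := F.exists_isMatching_of_edgeColoring_of_even_card (by simp) hD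
    (fun x => (hF x).trans_le (G.degree_le_maxDegree _)) {x | x.1 ∈ G.core}
    (fun x hx => (hF x).trans hx) (fun x y => c' x.1 y.1) (fun x y => hsymm _ _)
    (by
      intro x hx y hy h
      rw [hc' _ _ hx hy]
      exact hlt _ ((hadj _ _).1 h).1)
    (by
      intro v hv x hx y hy hvx hvy h
      rw [hadj] at hvx hvy
      rw [hc' _ _ hv hx, hc' _ _ hv hy] at h
      by_contra hxy
      refine hc s(⟨v.1, hv⟩, ⟨x.1, hx⟩) hvx.1 s(⟨v.1, hv⟩, ⟨y.1, hy⟩) hvy.1 (fun he => hxy ?_)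
        ⟨⟨v.1, hv⟩, Sym2.mem_mk_left _ _, Sym2.mem_mk_left _ _⟩ h
      rw [Sym2.congr_right, Subtype.mk.injEq] at he
      exact Prod.ext he (hvx.2.symm.trans hvy.2))
  refine ⟨
    { verts := {v | (v, false) ∈ M.verts}
      Adj := fun v w => M.Adj (v, false) (w, false)
      adj_sub := fun h => ((hadj _ _).1 h.adj_sub).1
      edge_vert := fun h => M.edge_vert h
      symm := ⟨fun v w h => h.symm⟩ }, ?_, fun v hv => hAM hv⟩
  intro v hv
  obtain ⟨⟨w, b⟩, hw, huniq⟩ := hM hv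
  obtain rfl : false = b := ((hadj _ _).1 hw.adj_sub).2
  exact ⟨w, hw, fun y hy => congrArg Prod.fst (huniq (y, false) hy)⟩
end

section
/- Let G be a finite simple graph of order n with at least one edge. If the subgraph of G induced by core(G) admits a proper edge coloring with Δ(G) colors (in particular, if G[core(G)] is Class 1, i.e., χ′(G[core(G)]) equals the maximum degree of G[core(G)], or if G itself is Class 1), then es_Δ(G) ≤ n/2. -/
open SimpleGraph

attribute [local instance] Classical.propDecidable

universe u

variable {V : Type u}

namespace SimpleGraph

/-- Proper edge colorings are transported along embeddings of the vertex set. -/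
theorem HasProperEdgeColoring.map {W : Type u} {H : SimpleGraph W} {k : ℕ}
    (h : H.HasProperEdgeColoring k) (f : W ↪ V) : (H.map f).HasProperEdgeColoring k := by
  obtain ⟨c, hck, hc⟩ := h
  have hext : ∀ e, Function.extend f.sym2Map c 0 (f.sym2Map e) = c e := fun e =>
    f.sym2Map.injective.extend_apply c 0 e
  refine ⟨Function.extend f.sym2Map c 0, ?_, ?_⟩
  · rw [edgeSet_map]
    rintro _ ⟨e, he, rfl⟩
    rw [hext]
    exact hck e he
  · rw [edgeSet_map]
    rintro _ ⟨e, he, rfl⟩ _ ⟨e', he', rfl⟩ hne ⟨v, hv, hv'⟩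
    rw [hext, hext]
    refine hc e he e' he' (fun h => hne (h ▸ rfl)) ?_
    obtain ⟨a, ha, rfl⟩ := Sym2.mem_map.1 hv
    obtain ⟨b, hb, hab⟩ := Sym2.mem_map.1 hv'
    exact ⟨a, ha, f.injective hab ▸ hb⟩

variable [Fintype V]

/-- An inclusion-minimal set of edges covering the core is mitigating. -/
theorem isMitigating_of_minimal (G : SimpleGraph V) (hE : G.edgeSet.Nonempty)
    {S : Set (Sym2 V)} (hS : S ⊆ G.edgeSet)
    (hmin : Minimal (fun S : Set (Sym2 V) => ∀ v ∈ G.core, ∃ e ∈ S, v ∈ e) S) :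
    G.IsMitigating S := by
  refine ⟨hS, le_antisymm (maxDegree_le_of_forall_degree_le _ _ fun v => ?_) ?_⟩
  · by_cases hv : v ∈ G.core
    · obtain ⟨e, heS, hve⟩ := hmin.1 v hv
      obtain ⟨w, rfl⟩ := hve
      have hadj : G.Adj v w := hS heS
      have hlt : (G.deleteEdges S).degree v < G.degree v := by
        refine Finset.card_lt_card (Finset.ssubset_iff_of_subset ?_ |>.2 ⟨w, ?_, ?_⟩)
        · intro x
          simp only [mem_neighborFinset, deleteEdges_adj]
          exact fun h => h.1
        · simpa using hadj
        · simp only [mem_neighborFinset, deleteEdges_adj]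
          exact fun h => h.2 heS
      have := G.degree_le_maxDegree v
      omega
    · have hle : (G.deleteEdges S).degree v ≤ G.degree v :=
        degree_le_of_le (deleteEdges_le _)
      have hne : G.degree v ≠ G.maxDegree := hv
      have := G.degree_le_maxDegree v
      omega
  · obtain ⟨e₀, -⟩ := hE
    have : Nonempty V := ⟨e₀.out.1⟩
    obtain ⟨u, hu⟩ := G.exists_maximal_degree_vertex
    obtain ⟨e, heS, -⟩ := hmin.1 u hu.symm
    have hnot : ¬ ∀ v ∈ G.core, ∃ e' ∈ S \ {e}, v ∈ e' := fun h =>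
      (hmin.2 h Set.sdiff_subset heS).2 rfl
    push Not at hnot
    obtain ⟨v, hv, hve⟩ := hnot
    obtain ⟨e', he'S, hve'⟩ := hmin.1 v hv
    have hee' : e' = e := by
      by_contra hne
      exact hve e' ⟨he'S, hne⟩ hve'
    obtain ⟨w, rfl⟩ := hve'
    have hsub : G.neighborFinset v ⊆
        insert w ((G.deleteEdges S).neighborFinset v) := by
      intro x hx
      rw [mem_neighborFinset] at hx
      rw [Finset.mem_insert, mem_neighborFinset, deleteEdges_adj]
      by_cases hxS : s(v, x) ∈ S
      · left
        by_contra hxw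
        refine hve s(v, x) ⟨hxS, fun h => hxw ?_⟩ (Sym2.mem_mk_left v x)
        exact Sym2.congr_right.1 (Eq.trans h hee'.symm)
      · exact Or.inr ⟨hx, hxS⟩
    have hcard := (Finset.card_le_card hsub).trans (Finset.card_insert_le _ _)
    rw [card_neighborFinset_eq_degree, card_neighborFinset_eq_degree] at hcard
    have hvΔ : G.degree v = G.maxDegree := hv
    have := (G.deleteEdges S).degree_le_maxDegree v
    omega

/-- The Δ-edge stability number is at most the size of any edge cover of the core. -/
theorem esDelta_le_card_of_cover (G : SimpleGraph V) (hE : G.edgeSet.Nonempty)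
    {T : Finset (Sym2 V)} (hT : (T : Set (Sym2 V)) ⊆ G.edgeSet)
    (hcov : ∀ v ∈ G.core, ∃ e ∈ T, v ∈ e) : G.esDelta ≤ T.card := by
  obtain ⟨S, hST, hmin⟩ := exists_minimal_le_of_wellFoundedLT
    (fun S : Set (Sym2 V) => ∀ v ∈ G.core, ∃ e ∈ S, v ∈ e) T hcov
  rw [← Set.ncard_coe_finset T]
  refine le_trans (Nat.sInf_le ?_) (Set.ncard_le_ncard hST)
  exact ⟨S, G.isMitigating_of_minimal hE (hST.trans hT) hmin, rfl⟩

/-- In a proper `k`-edge coloring, exactly `k - deg v` colors are missing at `v`. -/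
theorem card_missing_colors (H : SimpleGraph V) {k : ℕ} {c : Sym2 V → ℕ}
    (hck : ∀ e ∈ H.edgeSet, c e < k)
    (hc : ∀ e ∈ H.edgeSet, ∀ f ∈ H.edgeSet, e ≠ f → (∃ v, v ∈ e ∧ v ∈ f) → c e ≠ c f) (v : V) :
    ((Finset.range k).filter fun i => ∀ w, H.Adj v w → c s(v, w) ≠ i).card + H.degree v = k := by
  have himg : (H.neighborFinset v).image (fun w => c s(v, w)) =
      (Finset.range k).filter fun i => ¬ ∀ w, H.Adj v w → c s(v, w) ≠ i := by
    ext i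
    simp only [Finset.mem_image, mem_neighborFinset, Finset.mem_filter, Finset.mem_range]
    push Not
    exact ⟨fun ⟨w, hw, hi⟩ => ⟨hi ▸ hck _ hw, w, hw, hi⟩, fun h => h.2⟩
  have hinj : Set.InjOn (fun w => c s(v, w)) (H.neighborFinset v : Set V) := by
    intro x hx y hy hxy
    by_contra hne
    rw [Finset.mem_coe, mem_neighborFinset] at hx hy
    exact hc s(v, x) hx s(v, y) hy (fun h => hne (Sym2.congr_right.1 h))
      ⟨v, Sym2.mem_mk_left v x, Sym2.mem_mk_left v y⟩ hxy
  rw [← card_neighborFinset_eq_degree, ← Finset.card_image_of_injOn hinj, himg,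
    Finset.card_filter_add_card_filter_not, Finset.card_range]

theorem sum_card_neighbors_not_mem_le (G : SimpleGraph V) (C : Finset V) :
    ∑ v ∈ C, (Cᶜ.filter fun w => G.Adj v w).card ≤ Cᶜ.card * G.maxDegree := by
  have h := Finset.sum_card_bipartiteAbove_eq_sum_card_bipartiteBelow (s := C) (t := Cᶜ) G.Adj
  simp only [Finset.bipartiteAbove, Finset.bipartiteBelow] at h
  rw [h]
  refine Finset.sum_le_card_nsmul _ _ _ fun w _ => le_trans ?_ (G.degree_le_maxDegree w)
  refine Finset.card_le_card fun v hv => ?_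
  rw [mem_neighborFinset]
  exact (Finset.mem_filter.1 hv).2.symm

theorem degree_add_card_neighbors_not_mem (G H : SimpleGraph V) (C : Finset V)
    (hH : ∀ v w, H.Adj v w ↔ G.Adj v w ∧ v ∈ C ∧ w ∈ C) {v : V} (hv : v ∈ C) :
    H.degree v + (Cᶜ.filter fun w => G.Adj v w).card = G.degree v := by
  rw [← card_neighborFinset_eq_degree, ← card_neighborFinset_eq_degree,
    ← Finset.card_filter_add_card_filter_not (s := G.neighborFinset v) (· ∈ C)]
  congr 2
  · ext w
    simp [hH, hv]
  · ext w
    simp [and_comm]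

end SimpleGraph

/-- If `G[core(G)]` has a proper `Δ(G)`-edge coloring (in particular, if `G[core(G)]`
or `G` itself is Class 1), then `es_Δ(G) ≤ n/2`. -/
theorem stmt_17 [Fintype V] (G : SimpleGraph V) (hE : G.edgeSet.Nonempty)
    (hcol : (G.induce G.core).HasProperEdgeColoring G.maxDegree) :
    (G.esDelta : ℝ) ≤ (Fintype.card V : ℝ) / 2 := by
  have hΔ : 0 < G.maxDegree := by
    obtain ⟨e, he⟩ := hE
    induction e with
    | _ a b =>
      exact ((G.degree_pos_iff_exists_adj a).2 ⟨b, he⟩).trans_le (G.degree_le_maxDegree a)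
  let C : Finset V := Finset.univ.filter (· ∈ G.core)
  have hC : ∀ v, v ∈ C ↔ v ∈ G.core := fun v => by simp [C]
  obtain ⟨H, hH, c, hck, hc⟩ : ∃ H : SimpleGraph V,
      (∀ v w, H.Adj v w ↔ G.Adj v w ∧ v ∈ C ∧ w ∈ C) ∧
        H.HasProperEdgeColoring G.maxDegree := by
    refine ⟨(G.induce G.core).spanningCoe, fun v w => ?_, hcol.map (Function.Embedding.subtype _)⟩
    simp [hC, and_comm, and_left_comm, and_assoc]
  have hHG : H ≤ G := fun v w h => ((hH v w).1 h).1
  have hnbr : ∀ v, ∃ w, v ∈ G.core → G.Adj v w := by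
    intro v
    by_cases hv : v ∈ G.core
    · have hvΔ : G.degree v = G.maxDegree := hv
      obtain ⟨w, hw⟩ := (G.degree_pos_iff_exists_adj v).1 (hvΔ ▸ hΔ)
      exact ⟨w, fun _ => hw⟩
    · exact ⟨v, fun h => absurd h hv⟩
  choose f hf using hnbr
  let M : ℕ → Finset (Sym2 V) := fun i => H.edgeFinset.filter fun e => c e = i
  let U : ℕ → Finset V := fun i => C.filter fun v => ∀ w, H.Adj v w → c s(v, w) ≠ i
  let T : ℕ → Finset (Sym2 V) := fun i => M i ∪ (U i).image fun v => s(v, f v)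
  have hbound : ∀ i, G.esDelta ≤ (M i).card + (U i).card := by
    intro i
    refine le_trans (G.esDelta_le_card_of_cover hE (T := T i) ?_ ?_)
      ((Finset.card_union_le _ _).trans (Nat.add_le_add_left Finset.card_image_le _))
    · intro e he
      rcases Finset.mem_union.1 (Finset.mem_coe.1 he) with he | he
      · exact edgeSet_mono hHG (mem_edgeFinset.1 (Finset.mem_filter.1 he).1)
      · obtain ⟨v, hv, rfl⟩ := Finset.mem_image.1 he
        exact hf v ((hC v).1 (Finset.mem_filter.1 hv).1)
    · intro v hv
      by_cases hvi : ∀ w, H.Adj v w → c s(v, w) ≠ i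
      · exact ⟨s(v, f v), Finset.mem_union_right _ (Finset.mem_image_of_mem _
          (Finset.mem_filter.2 ⟨(hC v).2 hv, hvi⟩)), Sym2.mem_mk_left _ _⟩
      · push Not at hvi
        obtain ⟨w, hw, hcw⟩ := hvi
        exact ⟨s(v, w), Finset.mem_union_left _ (Finset.mem_filter.2
          ⟨mem_edgeFinset.2 hw, hcw⟩), Sym2.mem_mk_left _ _⟩
  have hM : ∑ i ∈ Finset.range G.maxDegree, (M i).card = H.edgeFinset.card :=
    (Finset.card_eq_sum_card_fiberwise fun e he =>
      Finset.mem_coe.2 (Finset.mem_range.2 (hck e (mem_edgeFinset.1 he)))).symm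
  have hdegsum : ∑ v ∈ C, H.degree v = 2 * H.edgeFinset.card := by
    rw [← H.sum_degrees_eq_twice_card_edges]
    refine Finset.sum_subset (Finset.subset_univ _) fun v _ hv => ?_
    rw [← Nat.le_zero, ← not_lt, H.degree_pos_iff_exists_adj]
    rintro ⟨w, hw⟩
    exact hv ((hH v w).1 hw).2.1
  have hU : ∑ i ∈ Finset.range G.maxDegree, (U i).card =
      ∑ v ∈ C, (Cᶜ.filter fun w => G.Adj v w).card := by
    have h := Finset.sum_card_bipartiteAbove_eq_sum_card_bipartiteBelow
      (s := C) (t := Finset.range G.maxDegree) fun v i => ∀ w, H.Adj v w → c s(v, w) ≠ i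
    simp only [Finset.bipartiteAbove, Finset.bipartiteBelow] at h
    refine h.symm.trans (Finset.sum_congr rfl fun v hv => ?_)
    have h₁ := H.card_missing_colors hck hc v
    have h₂ : H.degree v + (Cᶜ.filter fun w => G.Adj v w).card = G.degree v :=
      G.degree_add_card_neighbors_not_mem H C hH hv
    have h₃ : G.degree v = G.maxDegree := (hC v).1 hv
    omega
  have hCsum : ∑ v ∈ C, H.degree v + ∑ v ∈ C, (Cᶜ.filter fun w => G.Adj v w).card =
      C.card * G.maxDegree := by
    rw [← Finset.sum_add_distrib, ← smul_eq_mul, ← Finset.sum_const]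
    exact Finset.sum_congr rfl fun v hv =>
      (G.degree_add_card_neighbors_not_mem H C hH hv).trans ((hC v).1 hv)
  have htotal : G.maxDegree * (2 * G.esDelta) ≤ G.maxDegree * Fintype.card V := by
    have hle := Finset.card_nsmul_le_sum (Finset.range G.maxDegree)
      (fun i => (M i).card + (U i).card) G.esDelta fun i _ => hbound i
    rw [Finset.sum_add_distrib, hM, hU, Finset.card_range, smul_eq_mul] at hle
    have hout := G.sum_card_neighbors_not_mem_le C
    have hn := Finset.card_add_card_compl C
    rw [← hn]
    linarith
  have hfin : 2 * G.esDelta ≤ Fintype.card V := Nat.le_of_mul_le_mul_left htotal hΔ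
  rw [le_div_iff₀ two_pos, mul_comm]
  exact_mod_cast hfin
end

section
/- Let G be a finite simple graph that has no perfect matching, and let S ⊆ V(G) be a set of maximum cardinality among all sets T ⊆ V(G) satisfying o(G − T) > |T|, where o(H) denotes the number of connected components of H of odd order. Then every connected component of G − S has odd order and is factor critical. -/
open SimpleGraph

attribute [local instance] Classical.propDecidable

universe u

variable {V : Type u}

/-- The number of odd components of a graph `H` (components with an odd number of
vertices). -/
noncomputable def SimpleGraph.numOddComponents {W : Type u} (H : SimpleGraph W) : ℕ :=
  {c : H.ConnectedComponent | Odd c.supp.ncard}.ncard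

/-- A graph is factor critical if deleting any single vertex leaves a graph with a
perfect matching. -/
def SimpleGraph.FactorCritical {W : Type u} (H : SimpleGraph W) : Prop :=
  ∀ v : W, ∃ M : (H.induce {u | u ≠ v}).Subgraph, M.IsPerfectMatching

/-- `K` is the vertex set of a connected component of the subgraph of `G` induced by `A`,
expressed as a minimal nonempty subset of `A` closed under adjacency within `A`. -/
def SimpleGraph.IsComponentIn (G : SimpleGraph V) (A K : Set V) : Prop :=
  Minimal (fun L : Set V => L ⊆ A ∧ L.Nonempty ∧ ∀ x ∈ L, ∀ y ∈ A, G.Adj x y → y ∈ L) K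

/-- The vertex sets of the odd components of the subgraph of `G` induced by `A`. -/
def SimpleGraph.oddComponentsIn (G : SimpleGraph V) (A : Set V) : Set (Set V) :=
  {K | G.IsComponentIn A K ∧ Odd K.ncard}

namespace SimpleGraph

variable {W : Type*} {G : SimpleGraph V} {H : SimpleGraph W}

lemma image_supp_subset_of_closed (f : H ↪g G) {L : Set V}
    (hL : ∀ x ∈ L, ∀ y ∈ Set.range f, G.Adj x y → y ∈ L) {w : W} (hw : f w ∈ L) :
    f '' (H.connectedComponentMk w).supp ⊆ L := by
  rintro _ ⟨z, hz, rfl⟩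
  obtain ⟨p⟩ := (ConnectedComponent.exact hz).symm
  induction p with
  | nil => exact hw
  | cons h p ih =>
    exact ih (hL _ hw _ ⟨_, rfl⟩ (f.map_adj_iff.2 h))
      ((ConnectedComponent.sound p.reachable).symm)

lemma isComponentIn_image_supp (f : H ↪g G) (c : H.ConnectedComponent) :
    G.IsComponentIn (Set.range f) (f '' c.supp) := by
  refine ⟨⟨Set.image_subset_range _ _, c.nonempty_supp.image _, ?_⟩, ?_⟩
  · rintro _ ⟨x, hx, rfl⟩ _ ⟨y, rfl⟩ h
    exact ⟨y, (c.mem_supp_congr_adj (f.map_adj_iff.1 h)).1 hx, rfl⟩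
  · rintro L ⟨-, ⟨x, hx⟩, hL⟩ hLc
    obtain ⟨w, hw, rfl⟩ := hLc hx
    obtain rfl := (ConnectedComponent.mem_supp_iff _ _).1 hw
    exact image_supp_subset_of_closed f hL hx

lemma IsComponentIn.exists_eq_image_supp (f : H ↪g G) {K : Set V}
    (hK : G.IsComponentIn (Set.range f) K) : ∃ c : H.ConnectedComponent, f '' c.supp = K := by
  obtain ⟨x, hx⟩ := hK.prop.2.1
  obtain ⟨w, rfl⟩ := hK.prop.1 hx
  have hsub := image_supp_subset_of_closed f hK.prop.2.2 hx
  exact ⟨_, hsub.antisymm (hK.le_of_le (isComponentIn_image_supp f _).prop hsub)⟩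

lemma ncard_oddComponents_eq_ncard_oddComponentsIn (f : H ↪g G) :
    H.oddComponents.ncard = (G.oddComponentsIn (Set.range f)).ncard := by
  have himage : (fun c : H.ConnectedComponent => f '' c.supp) '' H.oddComponents =
      G.oddComponentsIn (Set.range f) := by
    ext K
    constructor
    · rintro ⟨c, hc, rfl⟩
      exact ⟨isComponentIn_image_supp f c, by rwa [Set.ncard_image_of_injective _ f.injective]⟩
    · rintro ⟨hK, hodd⟩
      obtain ⟨c, rfl⟩ := hK.exists_eq_image_supp f
      exact ⟨c, by rwa [Set.ncard_image_of_injective _ f.injective] at hodd, rfl⟩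
  rw [← himage, Set.ncard_image_of_injective]
  intro c d h
  exact ConnectedComponent.supp_injective (f.injective.image_injective h)

lemma ncard_oddComponents_induce (A : Set V) :
    (G.induce A).oddComponents.ncard = (G.oddComponentsIn A).ncard := by
  have hrange : Set.range (Embedding.induce (G := G) A) = A := Subtype.range_coe
  rw [ncard_oddComponents_eq_ncard_oddComponentsIn (Embedding.induce A), hrange]

lemma odd_ncard_oddComponentsIn [Finite V] (A : Set V) :
    Odd (G.oddComponentsIn A).ncard ↔ Odd A.ncard := by
  rw [← ncard_oddComponents_induce, odd_ncard_oddComponents, Nat.card_coe_set_eq]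

lemma IsComponentIn.disjoint {A K C : Set V} (hK : G.IsComponentIn A K)
    (hC : G.IsComponentIn A C) (hne : K ≠ C) : Disjoint K C := by
  by_contra h
  obtain ⟨x, hx⟩ := Set.not_disjoint_iff_nonempty_inter.1 h
  have hp : K ∩ C ⊆ A ∧ (K ∩ C).Nonempty ∧
      ∀ x ∈ K ∩ C, ∀ y ∈ A, G.Adj x y → y ∈ K ∩ C :=
    ⟨fun _ h => hK.prop.1 h.1, ⟨x, hx⟩, fun x hx y hy h =>
      ⟨hK.prop.2.2 x hx.1 y hy h, hC.prop.2.2 x hx.2 y hy h⟩⟩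
  exact hne ((hK.le_of_le hp Set.inter_subset_left).trans Set.inter_subset_right |>.antisymm
    ((hC.le_of_le hp Set.inter_subset_right).trans Set.inter_subset_left))

/-- A component of the subgraph induced by `A` remains one after shrinking `A` without
touching the component. -/
lemma IsComponentIn.anti {A B K : Set V} (hK : G.IsComponentIn A K) (hBA : B ⊆ A)
    (hKB : K ⊆ B) : G.IsComponentIn B K := by
  refine ⟨⟨hKB, hK.prop.2.1, fun x hx y hy => hK.prop.2.2 x hx y (hBA hy)⟩, ?_⟩
  rintro L ⟨-, hne, hL⟩ hLK
  exact hK.le_of_le ⟨hLK.trans hK.prop.1, hne, fun x hx y hy h =>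
    hL x hx y (hKB (hK.prop.2.2 x (hLK hx) y hy h)) h⟩ hLK

/-- A component of the subgraph induced by `A` remains one after enlarging `A` to `B`
if no edge of `G` joins `A` to `B \ A`. -/
lemma IsComponentIn.mono {A B K : Set V} (hK : G.IsComponentIn A K) (hAB : A ⊆ B)
    (hcl : ∀ x ∈ A, ∀ y ∈ B, G.Adj x y → y ∈ A) : G.IsComponentIn B K := by
  refine ⟨⟨hK.prop.1.trans hAB, hK.prop.2.1, fun x hx y hy h =>
    hK.prop.2.2 x hx y (hcl x (hK.prop.1 hx) y hy h) h⟩, ?_⟩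
  rintro L ⟨-, hne, hL⟩ hLK
  exact hK.le_of_le ⟨hLK.trans hK.prop.1, hne, fun x hx y hy => hL x hx y (hAB hy)⟩ hLK

/-- Deleting a set `X` of vertices of a component `C` replaces `C` by the components of
`C \ X` and leaves the other components unchanged. -/
lemma IsComponentIn.oddComponentsIn_diff_union_subset {A C X : Set V}
    (hC : G.IsComponentIn A C) (hX : X ⊆ C) :
    (G.oddComponentsIn A \ {C}) ∪ G.oddComponentsIn (C \ X) ⊆ G.oddComponentsIn (A \ X) := by
  rintro K (⟨⟨hK, hodd⟩, hne⟩ | ⟨hK, hodd⟩)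
  · refine ⟨hK.anti Set.sdiff_subset fun x hx => ⟨hK.prop.1 hx, fun hxX => ?_⟩, hodd⟩
    exact Set.disjoint_left.1 (hK.disjoint hC hne) hx (hX hxX)
  · exact ⟨hK.mono (Set.sdiff_subset_sdiff_left hC.prop.1) fun x hx y hy h =>
      ⟨hC.prop.2.2 x hx.1 y hy.1 h, hy.2⟩, hodd⟩

lemma IsComponentIn.ncard_oddComponentsIn_add_le [Finite V] {A C X : Set V}
    (hC : G.IsComponentIn A C) (hX : X ⊆ C) :
    (G.oddComponentsIn A \ {C}).ncard + (G.oddComponentsIn (C \ X)).ncard ≤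
      (G.oddComponentsIn (A \ X)).ncard := by
  rw [← Set.ncard_union_eq]
  · exact Set.ncard_le_ncard (hC.oddComponentsIn_diff_union_subset hX)
  · rw [Set.disjoint_left]
    rintro K ⟨⟨hK, -⟩, hne⟩ ⟨hK', -⟩
    obtain ⟨x, hx⟩ := hK.prop.2.1
    exact Set.disjoint_left.1 (hK.disjoint hC hne) hx (hK'.prop.1 hx).1

/-- A graph without a perfect matching has a Tutte violator, counted inside an ambient graph. -/
lemma exists_ncard_lt_ncard_oddComponentsIn [Finite W] (f : H ↪g G)
    (hH : ¬ ∃ M : H.Subgraph, M.IsPerfectMatching) :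
    ∃ U ⊆ Set.range f, U.ncard < (G.oddComponentsIn (Set.range f \ U)).ncard := by
  rw [tutte] at hH
  push Not at hH
  obtain ⟨u, hu⟩ := hH
  let g : ((⊤ : H.Subgraph).deleteVerts u).coe ↪g H :=
    { toFun := Subtype.val
      inj' := Subtype.val_injective
      map_rel_iff' := by
        rintro ⟨a, ha⟩ ⟨b, hb⟩
        have ha' := ha.2
        have hb' := hb.2
        simp [ha', hb'] }
  have hg : Set.range g = uᶜ := by
    change Set.range (Subtype.val : ((⊤ : H.Subgraph).deleteVerts u).verts → W) = _
    ext x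
    simp
  have hrange : Set.range (g.trans f) = Set.range f \ f '' u := by
    rw [← Set.image_compl_eq_range_sdiff_image f.injective, ← hg, ← Set.range_comp]
    rfl
  refine ⟨f '' u, Set.image_subset_range _ _, ?_⟩
  rw [Set.ncard_image_of_injective _ f.injective, ← hrange,
    ← ncard_oddComponents_eq_ncard_oddComponentsIn]
  exact hu

end SimpleGraph

/-- If `G` has no perfect matching and `S` has maximum cardinality among all sets `T`
with `o(G − T) > |T|`, then every component of `G − S` has odd order and is factor
critical. -/
theorem stmt_18 [Fintype V] (G : SimpleGraph V)
    (hnpm : ¬ ∃ M : G.Subgraph, M.IsPerfectMatching)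
    (S : Set V) (hS : S.ncard < (G.induce Sᶜ).numOddComponents)
    (hmax : ∀ T : Set V, T.ncard < (G.induce Tᶜ).numOddComponents → T.ncard ≤ S.ncard) :
    ∀ c : (G.induce Sᶜ).ConnectedComponent,
      Odd c.supp.ncard ∧ ((G.induce Sᶜ).induce c.supp).FactorCritical := by
  have hS' : S.ncard < (G.oddComponentsIn Sᶜ).ncard := by
    rw [← ncard_oddComponents_induce]
    exact hS
  intro c
  let C : Set V := Subtype.val '' c.supp
  have hCcard : C.ncard = c.supp.ncard := Set.ncard_image_of_injective _ Subtype.val_injective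
  have hC : G.IsComponentIn Sᶜ C := by
    have h := isComponentIn_image_supp (Embedding.induce (G := G) Sᶜ) c
    rwa [show Set.range (Embedding.induce (G := G) Sᶜ) = Sᶜ from Subtype.range_coe] at h
  have hdel : ∀ X ⊆ C, X.Nonempty →
      (G.oddComponentsIn Sᶜ \ {C}).ncard + (G.oddComponentsIn (C \ X)).ncard ≤
        S.ncard + X.ncard := by
    intro X hX hne
    have hcard : (S ∪ X).ncard = S.ncard + X.ncard :=
      Set.ncard_union_eq (Set.disjoint_left.2 fun x hxS hxX => hC.prop.1 (hX hxX) hxS)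
    have hpos := (Set.ncard_pos X.toFinite).2 hne
    have hnot : ¬ (S ∪ X).ncard < (G.oddComponentsIn (S ∪ X)ᶜ).ncard := fun h => by
      rw [← ncard_oddComponents_induce] at h
      have := hmax (S ∪ X) h
      omega
    have hle := hC.ncard_oddComponentsIn_add_le hX
    rw [Set.compl_union, ← Set.sdiff_eq] at hnot
    omega
  have hparity : ∀ X ⊆ C, (Odd (G.oddComponentsIn (C \ X)).ncard ↔ Odd (C.ncard - X.ncard)) ∧
      X.ncard ≤ C.ncard := fun X hX =>
    ⟨by rw [odd_ncard_oddComponentsIn, Set.ncard_sdiff hX], Set.ncard_le_ncard hX⟩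
  have hodd : Odd C.ncard := by
    by_contra hnot
    obtain ⟨v, hv⟩ := hC.prop.2.1
    have hX : {v} ⊆ C := Set.singleton_subset_iff.2 hv
    have h1 := hdel {v} hX (Set.singleton_nonempty v)
    obtain ⟨h2, h3⟩ := hparity {v} hX
    rw [Set.sdiff_singleton_eq_self fun h => hnot h.2] at h1
    rw [Set.ncard_singleton] at h1 h2 h3
    grind
  refine ⟨hCcard ▸ hodd, fun v => ?_⟩
  by_contra hM
  let f := (Embedding.induce (G := (G.induce Sᶜ).induce c.supp) {u | u ≠ v}).trans
    ((Embedding.induce (G := G.induce Sᶜ) c.supp).trans (Embedding.induce (G := G) Sᶜ))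
  have hf : Set.range f = C \ {v.1.1} := by
    ext x
    constructor
    · rintro ⟨⟨a, ha⟩, rfl⟩
      exact ⟨⟨a.1, a.2, rfl⟩, fun h => ha (Subtype.ext (Subtype.ext h))⟩
    · rintro ⟨⟨a, ha, rfl⟩, hne⟩
      exact ⟨⟨⟨a, ha⟩, fun h => hne (congrArg (fun z : c.supp => z.1.1) h)⟩, rfl⟩
  obtain ⟨U, hU, hlt⟩ := exists_ncard_lt_ncard_oddComponentsIn f hM
  rw [hf] at hU hlt
  have hX : insert v.1.1 U ⊆ C :=
    Set.insert_subset ⟨v.1, v.2, rfl⟩ (hU.trans Set.sdiff_subset)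
  have hcard : (insert v.1.1 U).ncard = U.ncard + 1 :=
    Set.ncard_insert_of_notMem fun h => (hU h).2 rfl
  have h1 := hdel _ hX (Set.insert_nonempty _ _)
  obtain ⟨h2, h3⟩ := hparity _ hX
  have h4 := Set.ncard_sdiff_singleton_add_one (show C ∈ G.oddComponentsIn Sᶜ from ⟨hC, hodd⟩)
  rw [Set.sdiff_sdiff, Set.singleton_union] at hlt
  grind
end
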